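/- arXiv:math/0102125 — 4 statements merged into one kernel-verified Lean document; each statement's English description precedes it below -/
import Mathlib

section
/- Let p be an odd prime and let f be a squarefree polynomial of odd degree 2g+1 (g ≥ 1) over the prime finite field F_p. Then the number N of affine points (x,y) ∈ F_p × F_p satisfying y² = f(x) satisfies the Weil bound |N − p| ≤ 2g·√p. -/
open Polynomial UniqueFactorizationMonoid

theorem Polynomial.natCard_degreeLT (K : Type*) [Field K] [Finite K] (n : ℕ) :
    Nat.card (degreeLT K n) = Nat.card K ^ n := by
  rw [Nat.card_congr (degreeLTEquiv K n).toEquiv, Nat.card_fun, Nat.card_fin]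

instance (K : Type*) [Field K] [Finite K] (n : ℕ) : Finite (degreeLT K n) :=
  Finite.of_equiv _ (degreeLTEquiv K n).symm.toEquiv

theorem Polynomial.natDegree_lt_of_degree_lt_of_pos {R : Type*} [Semiring R] {n : ℕ} (hn : 0 < n)
    {p : R[X]} (h : p.degree < n) : p.natDegree < n := by
  rcases eq_or_ne p 0 with rfl | hp
  · simpa
  · exact (natDegree_lt_iff_degree_lt hp).2 h

/-- The coefficients of the auxiliary polynomial of the Stepanov method. -/
theorem exists_stepanov_coeffs {K : Type*} [Field K] [Finite K] (p m : ℕ) [Fact p.Prime] [CharP K p]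
    (g H H' : ℕ) (f : K[X]) (hf : f.natDegree = 2 * g + 1) (c : K)
    (hH : 2 * H = p ^ m + (2 * g + 1)) (hH' : 2 * H' + (2 * g + 1) = p ^ m) (h0 : 0 < H') :
    ∃ a e : Fin H → K[X], (∀ i, (a i).degree < H) ∧ (∀ i, (e i).degree < H') ∧
      (∃ i, a i ≠ 0 ∨ e i ≠ 0) ∧
      ∑ i, (a i ^ p ^ m + C c * f ^ ((p ^ m + 1) / 2) * e i ^ p ^ m) * X ^ (i : ℕ) = 0 := by
  set Q := p ^ m with hQ
  let Φ : (Fin H → degreeLT K H × degreeLT K H') → K[X] := fun v ↦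
    ∑ i, ((v i).1.1 ^ Q + C c * f ^ ((Q + 1) / 2) * (v i).2.1 ^ Q) * X ^ (i : ℕ)
  have hf0 : f ≠ 0 := by rintro rfl; simp at hf
  have hdd : ((Q + 1) / 2) * (2 * g + 1) = g * Q + H := by
    have : 2 * ((Q + 1) / 2) = Q + 1 := by omega
    nlinarith
  have hΦ : ∀ v, Φ v ∈ degreeLT K (Q * (H - 1) + H) := by
    intro v
    refine Submodule.sum_mem _ fun i _ ↦ ?_
    rw [mem_degreeLT]
    have h1 := mem_degreeLT.1 (v i).1.2
    have h2 := mem_degreeLT.1 (v i).2.2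
    have hi := i.2
    have h1' : (v i).1.1.natDegree ≤ H - 1 := by
      have := natDegree_lt_of_degree_lt_of_pos (by omega) h1
      omega
    have h2' : (v i).2.1.natDegree ≤ H' - 1 := by
      have := natDegree_lt_of_degree_lt_of_pos (by omega) h2
      omega
    refine degree_le_natDegree.trans_lt (Nat.cast_lt.2 ?_)
    have hX : natDegree (X ^ (i : ℕ) : K[X]) = i := natDegree_X_pow _
    have ha : ((v i).1.1 ^ Q).natDegree ≤ Q * (H - 1) :=
      natDegree_pow_le.trans (Nat.mul_le_mul_left _ h1')
    have he : (C c * f ^ ((Q + 1) / 2) * (v i).2.1 ^ Q).natDegree ≤ Q * (H - 1) := by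
      have e1 : ((v i).2.1 ^ Q).natDegree ≤ Q * (H' - 1) :=
        natDegree_pow_le.trans (Nat.mul_le_mul_left _ h2')
      have e2 : (C c * f ^ ((Q + 1) / 2)).natDegree ≤ g * Q + H := by
        refine (natDegree_C_mul_le _ _).trans (natDegree_pow_le.trans ?_)
        rw [hf, hdd]
      refine natDegree_mul_le.trans ((add_le_add e2 e1).trans ?_)
      obtain ⟨H', rfl⟩ : ∃ k, H' = k + 1 := ⟨H' - 1, by omega⟩
      obtain ⟨H, rfl⟩ : ∃ k, H = k + 1 := ⟨H - 1, by omega⟩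
      simp only [Nat.add_sub_cancel]
      have : H = H' + 2 * g + 1 := by omega
      subst this
      nlinarith
    have := (natDegree_mul_le (p := ((v i).1.1 ^ Q + C c * f ^ ((Q + 1) / 2) * (v i).2.1 ^ Q))
      (q := X ^ (i : ℕ))).trans
      (add_le_add ((natDegree_add_le_of_degree_le ha he)) hX.le)
    omega
  have hcard : Nat.card (degreeLT K (Q * (H - 1) + H)) <
      Nat.card (Fin H → degreeLT K H × degreeLT K H') := by
    rw [natCard_degreeLT, Nat.card_fun, Nat.card_prod, natCard_degreeLT, natCard_degreeLT,
      Nat.card_fin, ← pow_add, ← pow_mul]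
    refine Nat.pow_lt_pow_right Finite.one_lt_card ?_
    obtain ⟨k, rfl⟩ : ∃ k, H = k + 1 := ⟨H - 1, by omega⟩
    have : k + 1 + H' = Q := by omega
    rw [this, Nat.add_sub_cancel]
    nlinarith
  obtain ⟨v, w, hvw, h⟩ : ∃ v w, v ≠ w ∧ Φ v = Φ w := by
    by_contra! hcon
    have hinj : Function.Injective fun v ↦ (⟨Φ v, hΦ v⟩ : degreeLT K (Q * (H - 1) + H)) := by
      intro v w h
      by_contra hne
      exact hcon v w hne (congrArg Subtype.val h)
    exact absurd (Nat.card_le_card_of_injective _ hinj) (not_le.2 hcard)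
  refine ⟨fun i ↦ (v i).1.1 - (w i).1.1, fun i ↦ (v i).2.1 - (w i).2.1,
    fun i ↦ mem_degreeLT.1 (sub_mem (v i).1.2 (w i).1.2),
    fun i ↦ mem_degreeLT.1 (sub_mem (v i).2.2 (w i).2.2), ?_, ?_⟩
  · by_contra! hcon
    refine hvw (funext fun i ↦ Prod.ext (Subtype.ext ?_) (Subtype.ext ?_))
    · exact sub_eq_zero.1 (hcon i).1
    · exact sub_eq_zero.1 (hcon i).2
  · rw [← sub_eq_zero] at h
    rw [← h, ← Finset.sum_sub_distrib]
    refine Finset.sum_congr rfl fun i _ ↦ ?_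
    rw [hQ, sub_pow_char_pow, sub_pow_char_pow]
    ring

/-- Distinct summands have distinct degrees, so the sum cannot vanish. -/
theorem stepanov_sum_ne_zero {K : Type*} [Field K] (Q g H H' : ℕ) (F : K[X]) (hF : F ≠ 0)
    (hFd : F.natDegree = g * Q + H) (hHH : H + H' = Q) (a e : Fin H → K[X])
    (ha : ∀ i, (a i).degree < H) (he : ∀ i, (e i).degree < H')
    (hne : ∃ i, a i ≠ 0 ∨ e i ≠ 0) :
    ∑ i, (a i + F * e i) * X ^ (i * Q : ℕ) ≠ 0 := by
  intro h0
  let t : Fin H ⊕ Fin H → K[X] :=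
    Sum.elim (fun i ↦ a i * X ^ (i * Q : ℕ)) fun i ↦ F * e i * X ^ (i * Q : ℕ)
  have hnat : ∀ i, a i ≠ 0 → (a i).natDegree < H :=
    fun i hi ↦ (natDegree_lt_iff_degree_lt hi).2 (ha i)
  have hnat' : ∀ i, e i ≠ 0 → (e i).natDegree < H' :=
    fun i hi ↦ (natDegree_lt_iff_degree_lt hi).2 (he i)
  have hdegl : ∀ i, a i ≠ 0 → (a i * X ^ (i * Q : ℕ)).natDegree = (a i).natDegree + Q * i := by
    intro i hi
    rw [natDegree_mul hi (by simp), natDegree_X_pow, mul_comm]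
  have hdegr : ∀ i, e i ≠ 0 → (F * e i * X ^ (i * Q : ℕ)).natDegree =
      (H + (e i).natDegree) + Q * (i + g) := by
    intro i hi
    rw [natDegree_mul (mul_ne_zero hF hi) (by simp), natDegree_mul hF hi, natDegree_X_pow, hFd]
    ring
  have key : ∀ r s i j : ℕ, r < Q → s < Q → r + Q * i = s + Q * j → r = s ∧ i = j := by
    intro r s i j hr hs h
    have h1 := congrArg (· % Q) h
    have h2 := congrArg (· / Q) h
    simp only [Nat.add_mul_mod_self_left, Nat.mod_eq_of_lt hr, Nat.mod_eq_of_lt hs] at h1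
    simp only [Nat.add_mul_div_left _ _ (show 0 < Q by omega), Nat.div_eq_of_lt hr,
      Nat.div_eq_of_lt hs] at h2
    omega
  have hpair : Set.Pairwise {i | i ∈ (Finset.univ : Finset (Fin H ⊕ Fin H)) ∧ t i ≠ 0}
      (Function.onFun Ne (degree ∘ t)) := by
    rintro (i | i) ⟨-, hi⟩ (j | j) ⟨-, hj⟩ hij heq <;>
    replace heq := natDegree_eq_of_degree_eq heq <;>
    simp only [t, Sum.elim_inl, Sum.elim_inr] at hi hj heq
    · have hi' := left_ne_zero_of_mul hi
      have hj' := left_ne_zero_of_mul hj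
      rw [hdegl i hi', hdegl j hj'] at heq
      have := key _ _ _ _ (by have := hnat i hi'; omega) (by have := hnat j hj'; omega) heq
      exact hij (congrArg _ (Fin.ext this.2))
    · have hi' := left_ne_zero_of_mul hi
      have hj' := right_ne_zero_of_mul (left_ne_zero_of_mul hj)
      rw [hdegl i hi', hdegr j hj'] at heq
      have h3 := hnat i hi'
      have := key _ _ _ _ (by omega) (by have := hnat' j hj'; omega) heq
      omega
    · have hi' := right_ne_zero_of_mul (left_ne_zero_of_mul hi)
      have hj' := left_ne_zero_of_mul hj
      rw [hdegr i hi', hdegl j hj'] at heq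
      have h3 := hnat j hj'
      have := key _ _ _ _ (by have := hnat' i hi'; omega) (by omega) heq
      omega
    · have hi' := right_ne_zero_of_mul (left_ne_zero_of_mul hi)
      have hj' := right_ne_zero_of_mul (left_ne_zero_of_mul hj)
      rw [hdegr i hi', hdegr j hj'] at heq
      have := key _ _ _ _ (by have := hnat' i hi'; omega) (by have := hnat' j hj'; omega) heq
      exact hij (congrArg _ (Fin.ext (by omega)))
  have hsum := degree_sum_eq_of_disjoint t Finset.univ hpair
  have hsum0 : Finset.univ.sum t = 0 := by
    rw [Fintype.sum_sum_type, ← h0, ← Finset.sum_add_distrib]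
    exact Finset.sum_congr rfl fun i _ ↦ by simp; ring
  rw [hsum0, degree_zero, eq_comm, Finset.sup_eq_bot_iff] at hsum
  obtain ⟨i, hi | hi⟩ := hne
  · have := degree_eq_bot.1 (hsum (.inl i) (Finset.mem_univ _))
    simp [t, hi] at this
  · have := degree_eq_bot.1 (hsum (.inr i) (Finset.mem_univ _))
    simp [t, hi, hF] at this

/-- The Stepanov bound for the number of points where `f` vanishes or has a given character. -/
theorem stepanov_card_le {K : Type*} [Field K] [Finite K] (p m : ℕ) [Fact p.Prime] [CharP K p]
    (hK : Nat.card K = (p ^ m) ^ 2) (hp : Odd p)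
    (g : ℕ) (f : K[X]) (hf : f.natDegree = 2 * g + 1) (c : K) (T : Finset K)
    (hT : ∀ x ∈ T, f.eval x ^ ((Nat.card K - 1) / 2) = c ∨ f.eval x = 0)
    (hlt : 2 * g + 1 < p ^ m) :
    2 * T.card ≤ Nat.card K + (4 * g + 1) * p ^ m := by
  have hQodd : Odd (p ^ m) := hp.pow
  obtain ⟨s, hs⟩ := hQodd
  obtain ⟨H, hH⟩ : ∃ H, 2 * H = p ^ m + (2 * g + 1) := ⟨s + g + 1, by omega⟩
  obtain ⟨H', hH'⟩ : ∃ H', 2 * H' + (2 * g + 1) = p ^ m := ⟨s - g, by omega⟩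
  obtain ⟨a, e, ha, he, hne, hsum⟩ :=
    exists_stepanov_coeffs p m g H H' f hf c hH hH' (by omega)
  set Q := p ^ m with hQ
  have hf0 : f ≠ 0 := by rintro rfl; simp at hf
  have hFd : (f ^ ((Q + 1) / 2)).natDegree = g * Q + H := by
    rw [natDegree_pow, hf]
    have : 2 * ((Q + 1) / 2) = Q + 1 := by omega
    nlinarith
  set F := f ^ ((Q + 1) / 2) with hFdef
  have hV := stepanov_sum_ne_zero Q g H H' F (pow_ne_zero _ hf0) hFd (by omega) a e ha he hne
  set V := ∑ i, (a i + F * e i) * X ^ (i * Q : ℕ) with hVdef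
  have hroot : ∀ x ∈ T, V.IsRoot x := by
    intro x hx
    have hxq : ∀ z : K, z ^ (Q * Q) = z := by
      intro z
      have := Fintype.ofFinite K
      have := FiniteField.pow_card z
      rwa [← Nat.card_eq_fintype_card, hK, sq] at this
    have hFx : F.eval x ^ Q = c * F.eval x := by
      rw [hFdef, eval_pow]
      rcases hT x hx with h | h
      · rw [← h, ← pow_mul, ← pow_add, hK]
        congr 1
        rw [hs]
        have e1 : (2 * s + 1 + 1) / 2 = s + 1 := by omega
        have e2 : ((2 * s + 1) ^ 2 - 1) / 2 = 2 * s * (s + 1) := by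
          have : (2 * s + 1) ^ 2 = 2 * (2 * s * (s + 1)) + 1 := by ring
          omega
        rw [e1, e2]; ring
      · rw [h, zero_pow (by omega), zero_pow (by omega), mul_zero]
    have h0 := congrArg (eval x) hsum
    rw [eval_zero, eval_finsetSum] at h0
    have : V.eval x ^ Q = 0 := by
      rw [← h0, hVdef, eval_finsetSum, hQ, sum_pow_char_pow, ← hQ]
      refine Finset.sum_congr rfl fun i _ ↦ ?_
      simp only [eval_mul, eval_add, eval_pow, eval_X, eval_C]
      rw [mul_pow, hQ, add_pow_char_pow, ← hQ, mul_pow, hFx, ← pow_mul, mul_assoc (i : ℕ),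
        mul_comm (i : ℕ), pow_mul, hxq]
    exact eq_zero_of_pow_eq_zero this
  have hVdeg : V.natDegree ≤ (H + g) * Q := by
    refine natDegree_sum_le_of_forall_le _ _ fun i _ ↦ ?_
    have h1 : (a i).natDegree < H :=
      natDegree_lt_of_degree_lt_of_pos (by omega) (ha i)
    have h2 : (e i).natDegree < H' :=
      natDegree_lt_of_degree_lt_of_pos (by omega) (he i)
    have h3 : (a i + F * e i).natDegree ≤ g * Q + Q := by
      refine natDegree_add_le_of_degree_le ?_ (natDegree_mul_le.trans ?_)
      · nlinarith
      · rw [hFd]; omega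
    refine natDegree_mul_le.trans ?_
    rw [natDegree_X_pow]
    have hi := i.2
    nlinarith
  have hcard : T.card ≤ V.natDegree := by
    classical
    refine (Finset.card_le_card (t := V.roots.toFinset) fun x hx ↦ ?_).trans
      ((Multiset.toFinset_card_le _).trans (card_roots' V))
    rw [Multiset.mem_toFinset, mem_roots hV]
    exact hroot x hx
  rw [hK]
  nlinarith

/-- A bound of the right order for the character sum, over fields whose cardinality is a square. -/
theorem abs_sum_quadraticChar_le {K : Type*} [Field K] [Fintype K] [DecidableEq K] (p m : ℕ)
    [Fact p.Prime] [CharP K p] (hK : Fintype.card K = (p ^ m) ^ 2) (hp : Odd p)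
    (g : ℕ) (f : K[X]) (hf : f.natDegree = 2 * g + 1) :
    |∑ x, quadraticChar K (f.eval x)| ≤ (4 * g + 1) * (p : ℤ) ^ m := by
  have hK' : (Finset.univ : Finset K).card = (p ^ m) ^ 2 := hK
  have hbound : ∀ a : K, |quadraticChar K a| ≤ 1 := by
    intro a
    rcases eq_or_ne a 0 with rfl | ha
    · simp
    · rcases quadraticChar_dichotomy ha with h | h <;> simp [h]
  by_cases hlt : 2 * g + 1 < p ^ m
  swap
  · refine (Finset.abs_sum_le_sum_abs _ _).trans ((Finset.sum_le_sum fun x _ ↦ hbound _).trans ?_)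
    rw [Finset.sum_const, hK', nsmul_eq_mul, mul_one]
    push_cast
    have : (p : ℤ) ^ m ≤ 2 * g + 1 := by exact_mod_cast not_lt.1 hlt
    have h0 : (0 : ℤ) ≤ (p : ℤ) ^ m := by positivity
    nlinarith
  have hchar : ringChar K ≠ 2 := by
    rw [← CharP.eq K ‹CharP K p› (ringChar.charP K)]
    rintro rfl
    exact absurd hp (by decide)
  have hN : Nat.card K = (p ^ m) ^ 2 := by rw [Nat.card_eq_fintype_card, hK]
  have hodd : Fintype.card K % 2 = 1 := FiniteField.odd_card_of_char_ne_two hchar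
  have hdiv : (Nat.card K - 1) / 2 = Fintype.card K / 2 := by
    rw [Nat.card_eq_fintype_card]; omega
  have hT : ∀ ε : ℤ, 2 * (Finset.univ.filter fun x ↦ quadraticChar K (f.eval x) = ε ∨
      quadraticChar K (f.eval x) = 0).card ≤ (p ^ m) ^ 2 + (4 * g + 1) * p ^ m := by
    intro ε
    rw [← hN]
    refine stepanov_card_le p m hN hp g f hf (ε : K) _ (fun x hx ↦ ?_) hlt
    rw [Finset.mem_filter] at hx
    rcases hx.2 with h | h
    · left
      rw [hdiv, ← h, quadraticChar_eq_pow_of_char_ne_two' hchar]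
    · right
      exact quadraticChar_eq_zero_iff.1 h
  have h1 := hT 1
  have h2 := hT (-1)
  have e1 : ((Finset.univ.filter fun x ↦ quadraticChar K (f.eval x) = 1 ∨
      quadraticChar K (f.eval x) = 0).card : ℤ) * 2 - (p ^ m) ^ 2 ≥
      ∑ x, quadraticChar K (f.eval x) ∧
      ((Finset.univ.filter fun x ↦ quadraticChar K (f.eval x) = -1 ∨
      quadraticChar K (f.eval x) = 0).card : ℤ) * 2 - (p ^ m) ^ 2 ≥
      -∑ x, quadraticChar K (f.eval x) := by
    have hq : ((p : ℤ) ^ m) ^ 2 = ∑ x : K, 1 := by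
      rw [Finset.sum_const, hK', nsmul_eq_mul, mul_one]; push_cast; rfl
    rw [hq, Finset.card_filter, Finset.card_filter]
    push_cast
    rw [Finset.sum_mul, ← Finset.sum_sub_distrib, Finset.sum_mul, ← Finset.sum_sub_distrib,
      ← Finset.sum_neg_distrib]
    refine ⟨Finset.sum_le_sum fun x _ ↦ ?_, Finset.sum_le_sum fun x _ ↦ ?_⟩ <;>
    · by_cases h0 : f.eval x = 0
      · simp [h0]
      · rcases quadraticChar_dichotomy h0 with h | h <;> simp [h]
  zify at h1 h2
  rw [abs_le]
  constructor <;> linarith [e1.1, e1.2]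

/-- The norm of `f(x)` as a power of the resultant of the minimal polynomial of `x` and `f`. -/
theorem Algebra.norm_aeval_eq_resultant {F K : Type*} [Field F] [Field K] [Algebra F K]
    [FiniteDimensional F K] [Algebra.IsSeparable F K] (f : F[X]) (x : K) :
    Algebra.norm F (aeval x f) =
      resultant (minpoly F x) f ^ (Module.finrank F K / (minpoly F x).natDegree) := by
  classical
  have hx := Algebra.IsIntegral.isIntegral (R := F) x
  have hfr : Module.finrank F K / (minpoly F x).natDegree =
      Module.finrank (IntermediateField.adjoin F {x}) K := by
    rw [← IntermediateField.adjoin.finrank hx, ← Module.finrank_mul_finrank F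
      (IntermediateField.adjoin F {x}) K]
    exact Nat.mul_div_cancel_left _ Module.finrank_pos
  have hgen : algebraMap (IntermediateField.adjoin F {x}) K
      (aeval (IntermediateField.AdjoinSimple.gen F x) f) = aeval x f := by
    rw [← aeval_algebraMap_apply, IntermediateField.AdjoinSimple.algebraMap_gen]
  rw [hfr, ← hgen, ← Algebra.norm_norm (S := IntermediateField.adjoin F {x}),
    Algebra.norm_algebraMap, map_pow]
  congr 1
  let E := AlgebraicClosure F
  apply (algebraMap F E).injective
  have hsep : Algebra.IsSeparable F (IntermediateField.adjoin F {x}) :=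
    Algebra.isSeparable_tower_bot_of_isSeparable F _ K
  rw [Algebra.norm_eq_prod_embeddings F E]
  have hres : algebraMap F E (resultant (minpoly F x) f) =
      (((minpoly F x).aroots E).map fun y ↦ aeval y f).prod := by
    rw [← resultant_map_map]
    have hd : (minpoly F x).natDegree = ((minpoly F x).map (algebraMap F E)).natDegree := by
      rw [natDegree_map]
    rw [hd, resultant_eq_prod_eval _ _ _ natDegree_map_le (IsAlgClosed.splits _),
      ((minpoly.monic hx).map _).leadingCoeff, one_pow, one_mul]
    simp [aroots, eval_map_algebraMap]
  rw [hres]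
  let pb := IntermediateField.adjoin.powerBasis hx
  have hmin : minpoly F pb.gen = minpoly F x := by
    rw [IntermediateField.adjoin.powerBasis_gen, IntermediateField.minpoly_gen]
  have hprod := Fintype.prod_equiv pb.liftEquiv'
    (fun σ : IntermediateField.adjoin F {x} →ₐ[F] E ↦
      σ (aeval (IntermediateField.AdjoinSimple.gen F x) f))
    (fun y ↦ aeval (y : E) f) (fun σ ↦ by
      rw [PowerBasis.liftEquiv'_apply_coe, ← aeval_algHom_apply,
        IntermediateField.adjoin.powerBasis_gen])
  rw [hprod, ← hmin]
  rw [Finset.prod_mem_multiset _ _ (fun y ↦ aeval y f) (fun _ ↦ rfl),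
    Finset.prod_eq_multiset_prod, Multiset.toFinset_val, Multiset.dedup_eq_self.mpr]
  exact nodup_roots (.map (Algebra.IsSeparable.isSeparable F pb.gen))

theorem quadraticChar_norm {F K : Type*} [Field F] [Fintype F] [DecidableEq F] [Field K] [Fintype K]
    [DecidableEq K] [Algebra F K] (hF : ringChar F ≠ 2) (z : K) :
    quadraticChar K z = quadraticChar F (Algebra.norm F z) := by
  have hchar : ringChar K = ringChar F := (Algebra.ringChar_eq F K).symm
  have hK : ringChar K ≠ 2 := hchar ▸ hF
  refine (quadraticChar_isQuadratic K).eq_of_eq_coe (quadraticChar_isQuadratic F) hK ?_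
  have h1 := congrArg (algebraMap F K)
    (quadraticChar_eq_pow_of_char_ne_two' hF (Algebra.norm F z))
  rw [map_intCast, map_pow, FiniteField.algebraMap_norm_eq_pow, ← pow_mul] at h1
  rw [quadraticChar_eq_pow_of_char_ne_two' hK, h1]
  congr 1
  rw [Nat.card_eq_fintype_card, Nat.card_eq_fintype_card]
  have hodd : Fintype.card F % 2 = 1 := FiniteField.odd_card_of_char_ne_two hF
  have hoddK : Fintype.card K % 2 = 1 := FiniteField.odd_card_of_char_ne_two hK
  have h2 : 1 < Fintype.card F := Fintype.one_lt_card
  obtain ⟨b, hb⟩ : Fintype.card F - 1 ∣ Fintype.card K - 1 := by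
    rw [Module.card_eq_pow_finrank (K := F) (V := K)]
    simpa using Nat.sub_dvd_pow_sub_pow (Fintype.card F) 1 (Module.finrank F K)
  rw [hb, Nat.mul_div_cancel_left _ (by omega)]
  obtain ⟨a, ha⟩ : ∃ a, Fintype.card F = 2 * a + 1 := ⟨Fintype.card F / 2, by omega⟩
  have e : Fintype.card K = 2 * (a * b) + 1 := by
    have : Fintype.card K - 1 = 2 * (a * b) := by rw [hb, ha, Nat.add_sub_cancel]; ring
    omega
  rw [e, ha]
  have e1 : (2 * (a * b) + 1) / 2 = a * b := by omega
  have e2 : (2 * a + 1) / 2 = a := by omega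
  rw [e1, e2, mul_comm]

theorem Polynomial.degree_C_mul_le_degree {R : Type*} [Semiring R] (c : R) (q : R[X]) :
    (C c * q).degree ≤ q.degree := by
  rw [← smul_eq_C_mul]
  exact degree_smul_le c q

section

variable {F : Type*} [Field F]

/-- Multiplies the remainder of `h` modulo `f` by the constant `c`. -/
noncomputable def scaleMod (f : F[X]) (c : F) (h : F[X]) : F[X] := f * (h / f) + C c * (h % f)

theorem scaleMod_scaleMod {f : F[X]} (hf : f ≠ 0) (c d : F) (h : F[X]) :
    scaleMod f c (scaleMod f d h) = scaleMod f (c * d) h := by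
  have hlt : (C d * (h % f)).degree < f.degree :=
    (degree_C_mul_le_degree _ _).trans_lt (degree_mod_lt _ hf)
  have hmod : scaleMod f d h % f = C d * (h % f) := by
    rw [scaleMod, add_mod, EuclideanDomain.mod_eq_zero.2 (dvd_mul_right f _), zero_add,
      (mod_eq_self_iff hf).2 hlt]
  have hdiv : scaleMod f d h / f = h / f := by
    have := EuclideanDomain.div_add_mod (scaleMod f d h) f
    rw [hmod] at this
    exact mul_left_cancel₀ hf (add_right_cancel (this.trans rfl))
  rw [scaleMod, hmod, hdiv, scaleMod, C_mul, mul_assoc]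

theorem scaleMod_one (f h : F[X]) : scaleMod f 1 h = h := by
  rw [scaleMod, C_1, one_mul, EuclideanDomain.div_add_mod]

variable [Fintype F]

variable (F) in
theorem finite_setOf_monic_natDegree_eq (n : ℕ) :
    {h : F[X] | h.Monic ∧ h.natDegree = n}.Finite := by
  have : ((degreeLT F (n + 1) : Submodule F F[X]) : Set F[X]).Finite :=
    @Set.toFinite _ _ (Finite.of_equiv _ (degreeLTEquiv F (n + 1)).symm.toEquiv)
  refine this.subset fun h hh ↦ ?_
  rw [SetLike.mem_coe, mem_degreeLT]
  exact degree_le_natDegree.trans_lt (Nat.cast_lt.2 (by have := hh.2; omega))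

variable (F) in
/-- The monic polynomials of degree `n` over a finite field. -/
noncomputable def monicsOfDegree (n : ℕ) : Finset F[X] :=
  (finite_setOf_monic_natDegree_eq F n).toFinset

theorem mem_monicsOfDegree {n : ℕ} {h : F[X]} :
    h ∈ monicsOfDegree F n ↔ h.Monic ∧ h.natDegree = n := by
  simp [monicsOfDegree]

theorem monicsOfDegree_zero : monicsOfDegree F 0 = {1} := by
  ext h
  rw [mem_monicsOfDegree, Finset.mem_singleton]
  constructor
  · rintro ⟨h1, h2⟩
    exact h1.natDegree_eq_zero.1 h2
  · rintro rfl
    simp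

theorem scaleMod_mem {f : F[X]} (hf : f ≠ 0) (c : F) {n : ℕ} (hn : f.natDegree ≤ n) {h : F[X]}
    (hh : h ∈ monicsOfDegree F n) : scaleMod f c h ∈ monicsOfDegree F n := by
  rw [mem_monicsOfDegree] at hh ⊢
  have hfn : f.degree ≤ h.degree := by
    rw [degree_eq_natDegree hf, degree_eq_natDegree hh.1.ne_zero, hh.2]
    exact_mod_cast hn
  have heq : scaleMod f c h = h + C (c - 1) * (h % f) := by
    have := EuclideanDomain.div_add_mod h f
    rw [scaleMod, C_sub, C_1]
    linear_combination this
  have hlt : (C (c - 1) * (h % f)).degree < h.degree :=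
    (degree_C_mul_le_degree _ _).trans_lt ((degree_mod_lt _ hf).trans_le hfn)
  rw [heq]
  refine ⟨hh.1.add_of_left hlt, ?_⟩
  rw [natDegree_add_eq_left_of_degree_lt hlt, hh.2]

/-- The quadratic residue symbol `(f / h)` for polynomials over a finite field. -/
noncomputable def polyQuadraticChar {F : Type*} [Field F] [Fintype F] [DecidableEq F]
    (f h : F[X]) : ℤ :=
  quadraticChar F (resultant h f)

variable [DecidableEq F]

theorem polyQuadraticChar_one (f : F[X]) : polyQuadraticChar f 1 = 1 := by
  simp [polyQuadraticChar]

theorem polyQuadraticChar_mul (f h₁ h₂ : F[X]) (h1 : h₁ ≠ 0) (h2 : h₂ ≠ 0) :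
    polyQuadraticChar f (h₁ * h₂) = polyQuadraticChar f h₁ * polyQuadraticChar f h₂ := by
  rw [polyQuadraticChar, natDegree_mul h1 h2, resultant_mul_left _ _ _ _ le_rfl, map_mul]
  rfl

theorem polyQuadraticChar_minpoly_pow {K : Type*} [Field K] [Fintype K] [DecidableEq K]
    [Algebra F K] (hF : ringChar F ≠ 2) (f : F[X]) (x : K) :
    polyQuadraticChar f ((minpoly F x) ^ (Module.finrank F K / (minpoly F x).natDegree)) =
      quadraticChar K (aeval x f) := by
  have hm := minpoly.monic (Algebra.IsIntegral.isIntegral (R := F) x)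
  rw [quadraticChar_norm hF, Algebra.norm_aeval_eq_resultant, polyQuadraticChar,
    resultant_pow_left _ _ _ _ (by simp [hm.leadingCoeff]) le_rfl]

theorem polyQuadraticChar_scaleMod {f : F[X]} (hf : Odd f.natDegree) (c : F) {n : ℕ}
    (hn : f.natDegree ≤ n) {h : F[X]} (hh : h ∈ monicsOfDegree F n) (hc : quadraticChar F c = -1) :
    polyQuadraticChar f (scaleMod f c h) = - polyQuadraticChar f h := by
  have hf0 : f ≠ 0 := by rintro rfl; simp at hf
  have hs := (mem_monicsOfDegree.1 (scaleMod_mem hf0 c hn hh)).2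
  rw [mem_monicsOfDegree] at hh
  have hdeg : (h / f).natDegree + f.natDegree ≤ n := by
    have h1 := degree_add_div hf0 (q := f) (p := h) (by
      rw [degree_eq_natDegree hf0, degree_eq_natDegree hh.1.ne_zero, hh.2]
      exact_mod_cast hn)
    have h2 : h / f ≠ 0 := by
      intro h0
      rw [h0, degree_zero, WithBot.add_bot, eq_comm, degree_eq_bot] at h1
      exact hh.1.ne_zero h1
    rw [degree_eq_natDegree hf0, degree_eq_natDegree h2, degree_eq_natDegree hh.1.ne_zero,
      hh.2] at h1
    have h3 : f.natDegree + (h / f).natDegree = n := by exact_mod_cast h1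
    omega
  have hres : ∀ d : F, resultant (scaleMod f d h) f n f.natDegree =
      d ^ f.natDegree * resultant (h % f) f n f.natDegree := by
    intro d
    rw [scaleMod, add_comm, resultant_add_mul_left _ _ _ _ _ hdeg le_rfl, resultant_C_mul_left]
  have h1 := hres 1
  rw [scaleMod_one, one_pow, one_mul] at h1
  rw [polyQuadraticChar, hs, hres, ← h1, map_mul, map_pow, hc, hf.neg_one_pow, polyQuadraticChar,
    hh.2]
  ring

/-- The coefficients of the `L`-function of `y² = f(x)` vanish from degree `deg f` on. -/
theorem sum_polyQuadraticChar_eq_zero (hF : ringChar F ≠ 2) {f : F[X]} (hf : Odd f.natDegree)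
    {n : ℕ} (hn : f.natDegree ≤ n) : ∑ h ∈ monicsOfDegree F n, polyQuadraticChar f h = 0 := by
  have hf0 : f ≠ 0 := by rintro rfl; simp at hf
  obtain ⟨c, hc⟩ := quadraticChar_exists_neg_one hF
  have hc0 : c ≠ 0 := by rintro rfl; simp at hc
  have : ∑ h ∈ monicsOfDegree F n, polyQuadraticChar f h =
      ∑ h ∈ monicsOfDegree F n, - polyQuadraticChar f h := by
    refine Finset.sum_nbij' (scaleMod f c⁻¹) (scaleMod f c) (fun h hh ↦ scaleMod_mem hf0 _ hn hh)
      (fun h hh ↦ scaleMod_mem hf0 _ hn hh) (fun h _ ↦ ?_) (fun h _ ↦ ?_) (fun h hh ↦ ?_)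
    · rw [scaleMod_scaleMod hf0, mul_inv_cancel₀ hc0, scaleMod_one]
    · rw [scaleMod_scaleMod hf0, inv_mul_cancel₀ hc0, scaleMod_one]
    · rw [← polyQuadraticChar_scaleMod hf c hn (scaleMod_mem hf0 _ hn hh) hc,
        scaleMod_scaleMod hf0, mul_inv_cancel₀ hc0, scaleMod_one]
  rw [Finset.sum_neg_distrib] at this
  omega

end

/-- If the power sums of `s` grow at most like `R ^ k`, then `s` lies in the disc of radius `R`. -/
theorem Multiset.norm_le_of_norm_powerSum_le (s : Multiset ℂ) (B R : ℝ) (hR : 0 < R)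
    (h : ∀ k : ℕ, 1 ≤ k → ‖(s.map (· ^ k)).sum‖ ≤ B * R ^ k) : ∀ z ∈ s, ‖z‖ ≤ R := by
  classical
  intro z hz
  by_contra! hlt
  let Q : ℂ[X] := ∏ b ∈ s.toFinset.erase z, (X - C b)
  have hQz : Q.eval z ≠ 0 := by
    rw [eval_prod, Finset.prod_ne_zero_iff]
    intro b hb
    simpa [sub_eq_zero] using (Finset.ne_of_mem_erase hb).symm
  have hQ0 : ∀ b ∈ s.toFinset, b ≠ z → Q.eval b = 0 := by
    intro b hb hbz
    rw [eval_prod]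
    exact Finset.prod_eq_zero (Finset.mem_erase.2 ⟨hbz, hb⟩) (by simp)
  have hsum1 : ∀ k, (s.map fun b ↦ Q.eval b * b ^ k).sum = s.count z * (Q.eval z * z ^ k) := by
    intro k
    rw [Finset.sum_multiset_map_count, Finset.sum_eq_single z]
    · rw [nsmul_eq_mul]
    · intro b hb hbz
      simp [hQ0 b hb hbz]
    · intro hz'
      exact absurd (Multiset.mem_toFinset.2 hz) hz'
  have hsum2 : ∀ k, (s.map fun b ↦ Q.eval b * b ^ k).sum =
      ∑ l ∈ Finset.range (Q.natDegree + 1), Q.coeff l * (s.map (· ^ (k + l))).sum := by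
    intro k
    simp_rw [← Multiset.sum_map_mul_left]
    rw [← Multiset.sum_map_sum]
    congr 1
    refine Multiset.map_congr rfl fun b _ ↦ ?_
    rw [eval_eq_sum_range, Finset.sum_mul]
    exact Finset.sum_congr rfl fun l _ ↦ by ring
  set D := ∑ l ∈ Finset.range (Q.natDegree + 1), ‖Q.coeff l‖ * (B * R ^ l) with hD
  have hle : ∀ k : ℕ, 1 ≤ k → s.count z * (‖Q.eval z‖ * ‖z‖ ^ k) ≤ D * R ^ k := by
    intro k hk
    have : ‖(s.count z : ℂ) * (Q.eval z * z ^ k)‖ = s.count z * (‖Q.eval z‖ * ‖z‖ ^ k) := by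
      simp
    rw [← this, ← hsum1, hsum2, hD, Finset.sum_mul]
    refine norm_sum_le_of_le _ fun l _ ↦ ?_
    rw [norm_mul, mul_assoc]
    refine mul_le_mul_of_nonneg_left ?_ (norm_nonneg _)
    refine (h _ (by omega)).trans_eq ?_
    ring
  have hpos : 0 < s.count z * ‖Q.eval z‖ :=
    mul_pos (by exact_mod_cast Multiset.count_pos.2 hz) (norm_pos_iff.2 hQz)
  have htend := tendsto_pow_atTop_atTop_of_one_lt ((one_lt_div hR).2 hlt)
  obtain ⟨k, hk1, hk2⟩ := ((htend.eventually_gt_atTop (D / (s.count z * ‖Q.eval z‖))).and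
    (Filter.eventually_ge_atTop 1)).exists
  rw [div_pow, div_lt_div_iff₀ hpos (pow_pos hR k)] at hk1
  nlinarith [hle k hk2]

/-- Newton identities determine the power sums of the roots of `∑ k ≤ n, c k * X ^ (n - k)`. -/
theorem exists_multiset_powerSum_eq (n : ℕ) (c S : ℕ → ℂ) (hc0 : c 0 = 1)
    (hc : ∀ k, n < k → c k = 0)
    (h : ∀ k, 1 ≤ k → k * c k =
      ∑ a ∈ Finset.HasAntidiagonal.antidiagonal k with a.1 < k, c a.1 * S a.2) :
    ∃ s : Multiset ℂ, s.card = n ∧ ∀ k, 1 ≤ k → S k = -(s.map (· ^ k)).sum := by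
  classical
  let M : ℂ[X] := ∑ k ∈ Finset.range (n + 1), C (c k) * X ^ (n - k)
  have hcoeff : ∀ k ≤ n, M.coeff (n - k) = c k := by
    intro k hk
    rw [finsetSum_coeff, Finset.sum_eq_single k]
    · simp
    · intro j hj hjk
      rw [Finset.mem_range] at hj
      rw [coeff_C_mul_X_pow, if_neg (by omega)]
    · intro hk'
      exact absurd (Finset.mem_range.2 (by omega)) hk'
  have hle : M.natDegree ≤ n := natDegree_sum_le_of_forall_le _ _ fun k _ ↦
    (natDegree_C_mul_X_pow_le _ _).trans (Nat.sub_le _ _)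
  have hn : M.coeff n = 1 := by simpa [hc0] using hcoeff 0 (Nat.zero_le _)
  have hmonic : M.Monic := monic_of_natDegree_le_of_coeff_eq_one n hle hn
  have hdeg : M.natDegree = n := le_antisymm hle (le_natDegree_of_ne_zero (by simp [hn]))
  have hcard : M.roots.card = n := by rw [← hdeg, ← splits_iff_card_roots.1 (IsAlgClosed.splits M)]
  have hesymm : ∀ k, c k = (-1) ^ k * M.roots.esymm k := by
    intro k
    rcases le_or_gt k n with hk | hk
    · rw [← hcoeff k hk, coeff_eq_esymm_roots_of_splits (IsAlgClosed.splits M) (by omega),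
        hmonic.leadingCoeff, hdeg, one_mul, Nat.sub_sub_self hk]
    · rw [hc k hk, Multiset.esymm, Multiset.powersetCard_eq_empty k (by omega)]
      simp
  refine ⟨M.roots, hcard, fun k ↦ ?_⟩
  have newton : ∀ k : ℕ, k * M.roots.esymm k = (-1) ^ (k + 1) *
      ∑ a ∈ Finset.HasAntidiagonal.antidiagonal k with a.1 < k,
        (-1) ^ a.1 * M.roots.esymm a.1 * (M.roots.map (· ^ a.2)).sum := by
    intro k
    have := congrArg (MvPolynomial.aeval (fun x : M.roots.ToType ↦ (x.1 : ℂ)))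
      (MvPolynomial.mul_esymm_eq_sum M.roots.ToType ℂ k)
    simp only [map_mul, map_natCast, map_pow, map_neg, map_one, map_sum,
      MvPolynomial.aeval_esymm_eq_multiset_esymm, MvPolynomial.psum, MvPolynomial.aeval_X,
      Multiset.map_univ_coe] at this
    rw [this]
    congr 1
    refine Finset.sum_congr rfl fun a _ ↦ ?_
    congr 1
    rw [← Finset.sum_map_val]
    conv_rhs => rw [← Multiset.map_univ_coe M.roots, Multiset.map_map]
    rfl
  have newton' : ∀ k : ℕ, k * c k =
      ∑ a ∈ Finset.HasAntidiagonal.antidiagonal k with a.1 < k,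
        c a.1 * -(M.roots.map (· ^ a.2)).sum := by
    intro k
    have hs : (-1 : ℂ) ^ k * (-1) ^ (k + 1) = -1 := by
      rw [← pow_add]
      exact Odd.neg_one_pow ⟨k, by ring⟩
    rw [hesymm, mul_left_comm, newton, ← mul_assoc, hs, neg_one_mul, ← Finset.sum_neg_distrib]
    refine Finset.sum_congr rfl fun a _ ↦ ?_
    rw [hesymm]; ring
  induction k using Nat.strong_induction_on with
  | _ k ih =>
    intro hk
    have e := (h k hk).symm.trans (newton' k)
    have hmem : (0, k) ∈ (Finset.HasAntidiagonal.antidiagonal k).filter fun a ↦ a.1 < k := by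
      simp
      omega
    rw [← Finset.add_sum_erase _ _ hmem, ← Finset.add_sum_erase _ _ hmem] at e
    simp only [hc0, one_mul] at e
    refine add_right_cancel (e.trans (congrArg _ (Finset.sum_congr rfl fun a ha ↦ ?_)))
    rw [Finset.mem_erase, Finset.mem_filter, Finset.HasAntidiagonal.mem_antidiagonal, ne_eq,
      Prod.ext_iff] at ha
    rw [ih a.2 (by simp at ha; omega) (by omega)]

theorem card_filter_minpoly_eq {F K : Type*} [Field F] [Finite F] [DecidableEq F] [Field K]
    [Fintype K] [Algebra F K] {P : F[X]} (hP : Irreducible P) (hm : P.Monic) :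
    (Finset.univ.filter fun x : K ↦ minpoly F x = P).card =
      if P.natDegree ∣ Module.finrank F K then P.natDegree else 0 := by
  classical
  have hmem : ∀ x : K, minpoly F x = P ↔ x ∈ P.rootSet K := by
    intro x
    rw [mem_rootSet_of_ne hP.ne_zero]
    constructor
    · rintro rfl
      exact minpoly.aeval F x
    · exact fun h ↦ (minpoly.eq_of_irreducible_of_monic hP h hm).symm
  split_ifs with h
  · have hsplit : (P.map (algebraMap F K)).Splits := by
      have := Fintype.ofFinite F
      have h1 := (FiniteField.isSplittingField_sub K F).splits
      refine h1.of_dvd (map_ne_zero (FiniteField.X_pow_card_sub_X_ne_zero _ Fintype.one_lt_card))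
        ((map_dvd_map' _).2 ?_)
      rw [← Nat.card_eq_fintype_card, Module.natCard_eq_pow_finrank (K := F)]
      exact hP.natDegree_dvd_iff_dvd_X_pow_card_pow_sub_X.1 h
    rw [← card_rootSet_eq_natDegree (PerfectField.separable_of_irreducible hP) hsplit,
      ← Set.toFinset_card]
    congr 1
    ext x
    simp [hmem]
  · rw [Finset.card_eq_zero, Finset.filter_eq_empty_iff]
    rintro x - rfl
    exact h (minpoly.degree_dvd (Algebra.IsIntegral.isIntegral x))

theorem card_Icc_filter_dvd_div_le {d v n : ℕ} (hd : 0 < d) (h : v * d ≤ n) :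
    ((Finset.Icc 1 n).filter fun k ↦ d ∣ k ∧ k / d ≤ v).card = v := by
  have : (Finset.Icc 1 n).filter (fun k ↦ d ∣ k ∧ k / d ≤ v) = (Finset.Icc 1 v).image (d * ·) := by
    ext k
    simp only [Finset.mem_filter, Finset.mem_Icc, Finset.mem_image]
    constructor
    · rintro ⟨⟨h1, h2⟩, ⟨j, rfl⟩, h3⟩
      rw [Nat.mul_div_cancel_left _ hd] at h3
      exact ⟨j, ⟨Nat.pos_of_mul_pos_left h1, h3⟩, rfl⟩
    · rintro ⟨j, ⟨h1, h2⟩, rfl⟩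
      rw [Nat.mul_div_cancel_left _ hd]
      exact ⟨⟨Nat.mul_pos hd h1, by nlinarith⟩, dvd_mul_right _ _, h2⟩
  rw [this, Finset.card_image_of_injective _ (mul_right_injective₀ hd.ne'), Nat.card_Icc,
    Nat.add_sub_cancel]

/-- The logarithmic derivative of the factorization of a monic polynomial, coefficientwise. -/
theorem sum_card_filter_minpoly_pow_dvd {F : Type*} [Field F] [Finite F] [DecidableEq F]
    (K : ℕ → Type*) [∀ k, Field (K k)] [∀ k, Fintype (K k)] [∀ k, Algebra F (K k)]
    [∀ P Q : F[X], Decidable (P ∣ Q)]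
    (hK : ∀ k, 1 ≤ k → Module.finrank F (K k) = k) {n : ℕ} {h : F[X]} (hh : h.Monic)
    (hn : h.natDegree = n) :
    ∑ k ∈ Finset.Icc 1 n, (Finset.univ.filter fun x : K k ↦
      minpoly F x ^ (k / (minpoly F x).natDegree) ∣ h).card = n := by
  classical
  have hirr : ∀ P ∈ normalizedFactors h, Irreducible P ∧ P.Monic := fun P hP ↦ by
    rw [Polynomial.mem_normalizedFactors_iff hh.ne_zero] at hP
    exact ⟨hP.1, hP.2.1⟩
  have hpow : ∀ {P : F[X]}, Irreducible P → P.Monic → ∀ j, P ^ j ∣ h ↔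
      j ≤ (normalizedFactors h).count P := by
    intro P hP hPm j
    rw [pow_dvd_iff_le_emultiplicity, emultiplicity_eq_count_normalizedFactors hP hh.ne_zero,
      hPm.normalize_eq_self, Nat.cast_le]
  have hdeg : ((normalizedFactors h).map natDegree).sum = n := by
    have := leadingCoeff_mul_prod_normalizedFactors h
    rw [hh.leadingCoeff, C_1, one_mul] at this
    rw [← natDegree_multiset_prod_of_monic _ fun P hP ↦ (hirr P hP).2, this, hn]
  rw [Finset.sum_multiset_map_count] at hdeg
  have key : ∀ k ∈ Finset.Icc 1 n, (Finset.univ.filter fun x : K k ↦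
      minpoly F x ^ (k / (minpoly F x).natDegree) ∣ h).card =
      ∑ P ∈ (normalizedFactors h).toFinset,
        if P.natDegree ∣ k ∧ k / P.natDegree ≤ (normalizedFactors h).count P then
          P.natDegree else 0 := by
    intro k hk
    have hk1 := (Finset.mem_Icc.1 hk).1
    have : FiniteDimensional F (K k) := Module.Finite.of_finite
    rw [Finset.card_eq_sum_card_fiberwise (f := fun x ↦ minpoly F x)
      (t := (normalizedFactors h).toFinset)]
    · refine Finset.sum_congr rfl fun P hP ↦ ?_
      obtain ⟨h1, h2⟩ := hirr P (Multiset.mem_toFinset.1 hP)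
      rw [Finset.filter_filter]
      by_cases hle : k / P.natDegree ≤ (normalizedFactors h).count P
      · have hcard := card_filter_minpoly_eq (K := K k) h1 h2
        rw [hK k hk1] at hcard
        simp only [hle, and_true]
        rw [← hcard]
        congr 1
        ext x
        simp only [Finset.mem_filter, Finset.mem_univ, true_and, and_iff_right_iff_imp]
        rintro rfl
        exact (hpow h1 h2 _).2 hle
      · simp only [hle, and_false, if_false, Finset.card_eq_zero, Finset.filter_eq_empty_iff]
        rintro x - ⟨hx, rfl⟩
        exact hle ((hpow h1 h2 _).1 hx)
    · intro x hx
      have hx := (Finset.mem_filter.1 hx).2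
      have hxi := Algebra.IsIntegral.isIntegral (R := F) x
      rw [hpow (minpoly.irreducible hxi) (minpoly.monic hxi)] at hx
      have hdvd := minpoly.degree_dvd hxi
      rw [hK k hk1] at hdvd
      have := Nat.div_pos (Nat.le_of_dvd hk1 hdvd) (minpoly.natDegree_pos hxi)
      exact Multiset.mem_toFinset.2 (Multiset.count_pos.1 (this.trans_le hx))
  rw [Finset.sum_congr rfl key, Finset.sum_comm]
  refine Eq.trans (Finset.sum_congr rfl fun P hP ↦ ?_) hdeg
  rw [← Finset.sum_filter, Finset.sum_const, smul_eq_mul, smul_eq_mul]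
  congr 1
  refine card_Icc_filter_dvd_div_le (hirr P (Multiset.mem_toFinset.1 hP)).1.natDegree_pos ?_
  rw [← hdeg, ← smul_eq_mul]
  exact Finset.single_le_sum (f := fun P ↦ (normalizedFactors h).count P • P.natDegree)
    (fun _ _ ↦ Nat.zero_le _) hP

/-- The Newton recurrence between the coefficients of the `L`-function and the character sums. -/
theorem mul_sum_polyQuadraticChar {F : Type*} [Field F] [Fintype F] [DecidableEq F] (K : ℕ → Type*)
    [∀ k, Field (K k)] [∀ k, Fintype (K k)] [∀ k, DecidableEq (K k)] [∀ k, Algebra F (K k)]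
    (hK : ∀ k, 1 ≤ k → Module.finrank F (K k) = k) (hF : ringChar F ≠ 2) (f : F[X]) (n : ℕ) :
    n * ∑ h ∈ monicsOfDegree F n, polyQuadraticChar f h =
      ∑ k ∈ Finset.Icc 1 n, (∑ x : K k, quadraticChar (K k) (aeval x f)) *
        ∑ h ∈ monicsOfDegree F (n - k), polyQuadraticChar f h := by
  classical
  have key : ∀ k ∈ Finset.Icc 1 n, (∑ x : K k, quadraticChar (K k) (aeval x f)) *
      ∑ h ∈ monicsOfDegree F (n - k), polyQuadraticChar f h =
      ∑ h ∈ monicsOfDegree F n, polyQuadraticChar f h * (Finset.univ.filter fun x : K k ↦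
        minpoly F x ^ (k / (minpoly F x).natDegree) ∣ h).card := by
    intro k hk
    obtain ⟨hk1, hkn⟩ := Finset.mem_Icc.1 hk
    simp_rw [Finset.card_filter, Nat.cast_sum]
    rw [Finset.sum_mul]
    simp_rw [Finset.mul_sum (s := Finset.univ)]
    rw [Finset.sum_comm (s := monicsOfDegree F n)]
    refine Finset.sum_congr rfl fun x _ ↦ ?_
    have : FiniteDimensional F (K k) := Module.Finite.of_finite
    have hxi := Algebra.IsIntegral.isIntegral (R := F) x
    have hdvd := minpoly.degree_dvd hxi
    rw [hK k hk1] at hdvd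
    have hx := polyQuadraticChar_minpoly_pow hF f x
    rw [hK k hk1] at hx
    set P := minpoly F x ^ (k / (minpoly F x).natDegree) with hP
    have hPm : P.Monic := (minpoly.monic hxi).pow _
    have hPd : P.natDegree = k := by rw [hP, natDegree_pow, Nat.div_mul_cancel hdvd]
    simp_rw [Nat.cast_ite, Nat.cast_one, Nat.cast_zero, mul_ite, mul_one, mul_zero]
    rw [← Finset.sum_filter, ← hx, Finset.mul_sum]
    refine Finset.sum_nbij (P * ·) (fun h hh ↦ ?_)
      (fun a _ b _ hab ↦ mul_left_cancel₀ hPm.ne_zero hab)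
      (fun h hh ↦ ?_) (fun h hh ↦ ?_)
    · rw [mem_monicsOfDegree] at hh
      rw [Finset.mem_filter, mem_monicsOfDegree, hPm.natDegree_mul hh.1]
      exact ⟨⟨hPm.mul hh.1, by omega⟩, dvd_mul_right _ _⟩
    · obtain ⟨hh, q, rfl⟩ := Finset.mem_filter.1 hh
      rw [mem_monicsOfDegree] at hh
      have hq := hPm.of_mul_monic_left hh.1
      have hd := hh.2
      rw [hPm.natDegree_mul hq] at hd
      exact ⟨q, mem_monicsOfDegree.2 ⟨hq, by omega⟩, rfl⟩
    · rw [polyQuadraticChar_mul _ _ _ hPm.ne_zero (mem_monicsOfDegree.1 hh).1.ne_zero]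
  rw [Finset.sum_congr rfl key, Finset.sum_comm, Finset.mul_sum]
  refine Finset.sum_congr rfl fun h hh ↦ ?_
  obtain ⟨h1, h2⟩ := mem_monicsOfDegree.1 hh
  rw [← Finset.mul_sum, mul_comm]
  congr 1
  exact_mod_cast (sum_card_filter_minpoly_pow_dvd K hK h1 h2).symm

theorem natCard_setOf_sq_eq_eval {F : Type*} [Field F] [Fintype F] [DecidableEq F]
    (hF : ringChar F ≠ 2) (f : F[X]) :
    (Nat.card {xy : F × F // xy.2 ^ 2 = f.eval xy.1} : ℤ) =
      Fintype.card F + ∑ x, quadraticChar F (f.eval x) := by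
  classical
  have e : {xy : F × F // xy.2 ^ 2 = f.eval xy.1} ≃ Σ x : F, {y : F | y ^ 2 = f.eval x} :=
    { toFun := fun z ↦ ⟨z.1.1, z.1.2, z.2⟩
      invFun := fun z ↦ ⟨(z.1, z.2.1), z.2.2⟩ }
  rw [Nat.card_congr e, Nat.card_eq_fintype_card, Fintype.card_sigma, Nat.cast_sum]
  simp_rw [← Set.toFinset_card, quadraticChar_card_sqrts hF, Finset.sum_add_distrib]
  simp [add_comm]

theorem exists_multiset_sum_quadraticChar_eq {F : Type*} [Field F] [Fintype F] [DecidableEq F]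
    (K : ℕ → Type*) [∀ k, Field (K k)] [∀ k, Fintype (K k)] [∀ k, DecidableEq (K k)]
    [∀ k, Algebra F (K k)] (hK : ∀ k, 1 ≤ k → Module.finrank F (K k) = k) (hF : ringChar F ≠ 2)
    {f : F[X]} {g : ℕ} (hf : f.natDegree = 2 * g + 1) :
    ∃ s : Multiset ℂ, s.card = 2 * g ∧ ∀ k, 1 ≤ k →
      ((∑ x : K k, quadraticChar (K k) (aeval x f) : ℤ) : ℂ) = -(s.map (· ^ k)).sum := by
  refine exists_multiset_powerSum_eq (2 * g)
    (fun n ↦ ((∑ h ∈ monicsOfDegree F n, polyQuadraticChar f h : ℤ) : ℂ)) _ ?_ ?_ ?_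
  · simp [monicsOfDegree_zero, polyQuadraticChar_one]
  · intro k hk
    rw [sum_polyQuadraticChar_eq_zero hF ⟨g, hf⟩ (by omega), Int.cast_zero]
  · intro k _
    have := congrArg (Int.cast : ℤ → ℂ) (mul_sum_polyQuadraticChar K hK hF f k)
    rw [Int.cast_mul, Int.cast_natCast] at this
    rw [this, Int.cast_sum (Finset.Icc 1 k)]
    refine Finset.sum_nbij' (fun j ↦ (k - j, j)) Prod.snd ?_ ?_ ?_ ?_ ?_
    · intro j hj
      rw [Finset.mem_Icc] at hj
      rw [Finset.mem_filter, Finset.HasAntidiagonal.mem_antidiagonal]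
      dsimp only
      omega
    · intro a ha
      rw [Finset.mem_filter, Finset.HasAntidiagonal.mem_antidiagonal] at ha
      rw [Finset.mem_Icc]
      omega
    · exact fun _ _ ↦ rfl
    · intro a ha
      rw [Finset.mem_filter, Finset.HasAntidiagonal.mem_antidiagonal] at ha
      exact Prod.ext (by dsimp only; omega) rfl
    · intro j _
      rw [Int.cast_mul, mul_comm]

theorem abs_sum_quadraticChar_le_mul_sqrt (p : ℕ) [Fact p.Prime] (hodd : Odd p) (g : ℕ)
    (f : (ZMod p)[X]) (hf : f.natDegree = 2 * g + 1) :
    |((∑ x, quadraticChar (ZMod p) (f.eval x) : ℤ) : ℝ)| ≤ 2 * g * √p := by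
  classical
  have (k : ℕ) : Fintype (GaloisField p k) := Fintype.ofFinite _
  have hp0 : (0 : ℝ) < p := Nat.cast_pos.2 (Fact.out : p.Prime).pos
  have hF : ringChar (ZMod p) ≠ 2 := by
    rw [ZMod.ringChar_zmod_n]
    rintro rfl
    exact absurd hodd (by decide)
  have hcard : ∀ k, 1 ≤ k → Fintype.card (GaloisField p k) = p ^ k := fun k hk ↦ by
    rw [← Nat.card_eq_fintype_card, GaloisField.card p k (by omega)]
  have hfin : ∀ k, 1 ≤ k → Module.finrank (ZMod p) (GaloisField p k) = k := fun k hk ↦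
    GaloisField.finrank p (by omega)
  obtain ⟨s, hs, hsum⟩ := exists_multiset_sum_quadraticChar_eq (GaloisField p) hfin hF hf
  have hnorm : ∀ z ∈ s.map (· ^ 2), ‖z‖ ≤ p := by
    refine Multiset.norm_le_of_norm_powerSum_le _ (4 * g + 1) p hp0 fun m hm ↦ ?_
    have h1 := abs_sum_quadraticChar_le (K := GaloisField p (2 * m)) p m
      (by rw [hcard _ (by omega), ← pow_mul, mul_comm]) hodd g
      (f.map (algebraMap (ZMod p) (GaloisField p (2 * m)))) (by rw [natDegree_map, hf])
    simp_rw [eval_map_algebraMap] at h1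
    rw [Multiset.map_map]
    simp_rw [Function.comp_def, ← pow_mul]
    rw [← norm_neg, ← hsum _ (by omega), Complex.norm_intCast]
    exact_mod_cast h1
  have hnorm' : ∀ z ∈ s, ‖z‖ ≤ √p := fun z hz ↦ by
    have := hnorm _ (Multiset.mem_map_of_mem _ hz)
    rw [norm_pow] at this
    exact Real.le_sqrt_of_sq_le this
  have hone : ∑ x, quadraticChar (ZMod p) (f.eval x) =
      ∑ x : GaloisField p 1, quadraticChar (GaloisField p 1) (aeval x f) := by
    have hbij : Function.Bijective (algebraMap (ZMod p) (GaloisField p 1)) := by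
      rw [Fintype.bijective_iff_injective_and_card, hcard 1 le_rfl, ZMod.card, pow_one]
      exact ⟨(algebraMap (ZMod p) (GaloisField p 1)).injective, rfl⟩
    refine Fintype.sum_bijective _ hbij _ _ fun x ↦ ?_
    rw [quadraticChar_norm (F := ZMod p) (K := GaloisField p 1) hF, aeval_algebraMap_apply,
      Algebra.norm_algebraMap, hfin 1 le_rfl, pow_one, coe_aeval_eq_eval]
  have h1 := hsum 1 le_rfl
  rw [← hone] at h1
  simp only [pow_one, Multiset.map_id'] at h1
  calc |((∑ x, quadraticChar (ZMod p) (f.eval x) : ℤ) : ℝ)|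
      = ‖s.sum‖ := by rw [← norm_neg, ← h1, Complex.norm_intCast]
    _ ≤ (s.map norm).sum := norm_multiset_sum_le _
    _ ≤ (s.map norm).card • √p := Multiset.sum_le_card_nsmul _ _ (by simpa using hnorm')
    _ = 2 * g * √p := by rw [Multiset.card_map, hs, nsmul_eq_mul]; push_cast; ring

/-- **Weil bound** for hyperelliptic curves: for an odd prime `p` and a squarefree
polynomial `f` of odd degree `2g+1` (`g ≥ 1`) over `F_p`, the number `N` of affine
points `(x, y)` with `y² = f(x)` satisfies `|N - p| ≤ 2g√p`. -/
theorem weil_bound_hyperelliptic (p : ℕ) (hp : p.Prime) (hodd : Odd p)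
    (g : ℕ) (hg : 1 ≤ g) (f : Polynomial (ZMod p))
    (hdeg : f.natDegree = 2 * g + 1) (hsf : Squarefree f) :
    |(Nat.card {xy : ZMod p × ZMod p // xy.2 ^ 2 = f.eval xy.1} : ℝ) - (p : ℝ)|
      ≤ 2 * (g : ℝ) * Real.sqrt p := by
  have : Fact p.Prime := ⟨hp⟩
  have hF : ringChar (ZMod p) ≠ 2 := by
    rw [ZMod.ringChar_zmod_n]
    rintro rfl
    exact absurd hodd (by decide)
  have h1 := congrArg (Int.cast : ℤ → ℝ) (natCard_setOf_sq_eq_eval hF f)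
  rw [ZMod.card, Int.cast_natCast, Int.cast_add, Int.cast_natCast] at h1
  rw [h1, add_sub_cancel_left]
  exact abs_sum_quadraticChar_le_mul_sqrt p hodd g f hdeg
end

section
/- Let p be a prime with p ≥ 17 and let f be a squarefree polynomial of degree 5 over F_p. Then there exists a point (x,y) ∈ F_p × F_p with y² = f(x); that is, every hyperelliptic curve of genus 2 over F_p has an affine F_p-rational point for all primes p ≥ 17. -/
open Polynomial in
/-- If `(X - a) ^ m` divides both `P` and its derivative and `m` is invertible, then
`(X - a) ^ (m + 1)` divides `P`. -/
theorem X_sub_C_pow_succ_dvd_of_dvd_derivative {K : Type*} [Field K] {P : K[X]} {a : K} {m : ℕ}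
    (hm : ((m + 1 : ℕ) : K) ≠ 0) (h : (X - C a) ^ (m + 1) ∣ P)
    (h' : (X - C a) ^ (m + 1) ∣ derivative P) : (X - C a) ^ (m + 2) ∣ P := by
  obtain ⟨Q, rfl⟩ := h
  obtain ⟨R, hR⟩ := h'
  have hne : (X - C a) ^ m ≠ 0 := pow_ne_zero _ (X_sub_C_ne_zero a)
  have key : C ((m + 1 : ℕ) : K) * Q = (X - C a) * (R - derivative Q) := by
    apply mul_left_cancel₀ hne
    simp only [derivative_mul, derivative_pow, derivative_sub, derivative_X, derivative_C,
      Nat.add_sub_cancel] at hR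
    linear_combination hR
  have hdvd : (X - C a) ∣ Q :=
    (isUnit_C.mpr hm.isUnit).dvd_mul_left.mp ⟨_, key⟩
  rw [pow_succ _ (m + 1)]
  exact mul_dvd_mul_left _ hdvd

open Polynomial in
/-- A polynomial `P` vanishing at `a` and satisfying `f P' = u P + v L ^ 3` with `f a ≠ 0` and
`L a = 0` vanishes to order at least `4` at `a`, in characteristic not `2` or `3`. -/
theorem X_sub_C_pow_four_dvd {K : Type*} [Field K] (h2 : (2 : K) ≠ 0) (h3 : (3 : K) ≠ 0)
    {P f u v L : K[X]} {a : K} (hP : P.eval a = 0) (hL : L.eval a = 0) (hf : f.eval a ≠ 0)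
    (hode : f * derivative P = u * P + v * L ^ 3) : (X - C a) ^ 4 ∣ P := by
  have hcop : IsCoprime (X - C a) f := by
    rw [(irreducible_X_sub_C a).coprime_iff_not_dvd, dvd_iff_isRoot]
    exact hf
  have hL' : (X - C a) ^ 3 ∣ L ^ 3 := pow_dvd_pow_of_dvd (dvd_iff_isRoot.mpr hL) 3
  have step (m : ℕ) (hm3 : m + 1 ≤ 3) (hm : ((m + 1 : ℕ) : K) ≠ 0)
      (h : (X - C a) ^ (m + 1) ∣ P) : (X - C a) ^ (m + 2) ∣ P := by
    refine X_sub_C_pow_succ_dvd_of_dvd_derivative hm h ?_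
    refine (hcop.pow_left (m := m + 1)).dvd_of_dvd_mul_left ?_
    rw [hode]
    exact dvd_add (h.mul_left _) (((pow_dvd_pow _ hm3).trans hL').mul_left _)
  have d1 : (X - C a) ^ 1 ∣ P := by
    rw [pow_one]
    exact dvd_iff_isRoot.mpr hP
  exact step 2 le_rfl (by norm_num [h3]) <|
    step 1 (by norm_num) (by norm_num [h2]) <| step 0 (by norm_num) (by norm_num) d1

open Polynomial in
/-- A nonzero polynomial over a finite field vanishing to order at least `n` everywhere has degree
at least `n` times the size of the field. -/
theorem card_mul_le_natDegree {K : Type*} [Field K] [Fintype K] {P : K[X]} (hP : P ≠ 0) {n : ℕ}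
    (h : ∀ a, (X - C a) ^ n ∣ P) : Fintype.card K * n ≤ P.natDegree := by
  have hdvd : ∏ a : K, (X - C a) ^ n ∣ P :=
    Fintype.prod_dvd_of_coprime
      (fun _ _ hab => (pairwise_coprime_X_sub_C Function.injective_id hab).pow) h
  have hle := natDegree_le_of_dvd hdvd hP
  rwa [natDegree_prod_of_monic _ _ fun a _ => (monic_X_sub_C a).pow n,
    Finset.sum_congr rfl fun a _ => by rw [natDegree_pow, natDegree_X_sub_C, mul_one],
    Finset.sum_const, smul_eq_mul, Finset.card_univ] at hle

open Polynomial in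
/-- For `y ^ 2 = f` the second derivative of `y` is `y * secondNumerator f / (2 * f) ^ 2`. -/
noncomputable def secondNumerator {K : Type*} [Field K] (f : K[X]) : K[X] :=
  2 * f * derivative (derivative f) - derivative f ^ 2

open Polynomial in
/-- For `y ^ 2 = f` the third derivative of `y` is `y * thirdNumerator f / (2 * f) ^ 3`. -/
noncomputable def thirdNumerator {K : Type*} [Field K] (f : K[X]) : K[X] :=
  4 * (f * f * derivative (derivative (derivative f)))
    - 6 * (f * derivative f * derivative (derivative f))
    + 3 * (derivative f * derivative f * derivative f)

open Polynomial in
/-- The numerator of `48 f ^ 3 (G + T / y)`, where `y ^ 2 = f` and `T` is the cubic Taylor expansion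
of `y` with increment `L`. -/
noncomputable def taylorAux {K : Type*} [Field K] (f G L : K[X]) : K[X] :=
  48 * f ^ 3 * (G + 1) + 24 * f ^ 2 * derivative f * L + 6 * f * secondNumerator f * L ^ 2
    + thirdNumerator f * L ^ 3

open Polynomial in
theorem taylorAux_ode {K : Type*} [Field K] {f G L : K[X]}
    (hG : 2 * f * derivative G = -derivative f * G) (hL : derivative L = -1) :
    2 * f * derivative (taylorAux f G L) = 5 * derivative f * taylorAux f G L
      + (2 * f * derivative (thirdNumerator f) - 5 * derivative f * thirdNumerator f) * L ^ 3 := by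
  simp only [taylorAux, secondNumerator, thirdNumerator, derivative_add, derivative_sub,
    derivative_mul, derivative_pow, hL, derivative_ofNat, derivative_one]
  simp only [Nat.cast_ofNat, map_ofNat]
  linear_combination (48 * f ^ 3) * hG

open Polynomial in
theorem natDegree_thirdNumerator_le {K : Type*} [Field K] {f : K[X]} (hf : f.natDegree ≤ 5) :
    (thirdNumerator f).natDegree ≤ 12 := by
  have h1 : (derivative f).natDegree ≤ 4 := (natDegree_derivative_le f).trans (by omega)
  have h2 : (derivative (derivative f)).natDegree ≤ 3 :=
    (natDegree_derivative_le _).trans (by omega)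
  have h3 : (derivative (derivative (derivative f))).natDegree ≤ 2 :=
    (natDegree_derivative_le _).trans (by omega)
  unfold thirdNumerator
  compute_degree
  omega

open Polynomial in
theorem coeff_thirdNumerator {K : Type*} [Field K] {f : K[X]} (hf : f.natDegree ≤ 5) :
    (thirdNumerator f).coeff 12 = 15 * f.coeff 5 ^ 3 := by
  have h1 : (derivative f).natDegree ≤ 4 := (natDegree_derivative_le f).trans (by omega)
  have h2 : (derivative (derivative f)).natDegree ≤ 3 :=
    (natDegree_derivative_le _).trans (by omega)
  have h3 : (derivative (derivative (derivative f))).natDegree ≤ 2 :=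
    (natDegree_derivative_le _).trans (by omega)
  have e1 := coeff_mul_add_eq_of_natDegree_le (natDegree_mul_le_of_le hf hf) h3
  rw [coeff_mul_add_eq_of_natDegree_le hf hf] at e1
  have e2 := coeff_mul_add_eq_of_natDegree_le (natDegree_mul_le_of_le hf h1) h2
  rw [coeff_mul_add_eq_of_natDegree_le hf h1] at e2
  have e3 := coeff_mul_add_eq_of_natDegree_le (natDegree_mul_le_of_le h1 h1) h1
  rw [coeff_mul_add_eq_of_natDegree_le h1 h1] at e3
  norm_num [coeff_derivative] at e1 e2 e3
  simp only [thirdNumerator, coeff_add, coeff_sub, coeff_ofNat_mul, e1, e2, e3]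
  ring

open Polynomial in
theorem taylorAux_natDegree_le_and_coeff {K : Type*} [Field K] {f G : K[X]} {p : ℕ} (hp : 1 < p)
    (hf : f.natDegree ≤ 5) (hG : 2 * G.natDegree ≤ 5 * (p - 1)) :
    (taylorAux f G (X ^ p - X)).natDegree ≤ 12 + 3 * p ∧
      (taylorAux f G (X ^ p - X)).coeff (12 + 3 * p) = 15 * f.coeff 5 ^ 3 := by
  have h1 : (derivative f).natDegree ≤ 4 := (natDegree_derivative_le f).trans (by omega)
  have h2 : (derivative (derivative f)).natDegree ≤ 3 :=
    (natDegree_derivative_le _).trans (by omega)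
  have hLm : (X ^ p - X : K[X]).Monic := monic_X_pow_sub (by simpa using hp)
  have hLd : (X ^ p - X : K[X]).natDegree = p := FiniteField.X_pow_card_sub_X_natDegree_eq K hp
  unfold taylorAux
  generalize (X ^ p - X : K[X]) = L at hLm hLd ⊢
  have hlow : (48 * f ^ 3 * (G + 1) + 24 * f ^ 2 * derivative f * L
      + 6 * f * secondNumerator f * L ^ 2).natDegree < 12 + 3 * p := by
    refine Nat.lt_of_le_pred (by omega) ?_
    unfold secondNumerator
    compute_degree
    simp only [Nat.pred_eq_sub_one]
    omega
  have h3 := natDegree_thirdNumerator_le hf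
  have hL3 : (L ^ 3).natDegree = 3 * p := by rw [natDegree_pow, hLd]
  constructor
  · exact natDegree_add_le_of_degree_le hlow.le (natDegree_mul_le_of_le h3 hL3.le)
  · rw [coeff_add, coeff_eq_zero_of_natDegree_lt hlow, zero_add,
      coeff_mul_add_eq_of_natDegree_le h3 hL3.le, coeff_thirdNumerator hf, ← hL3,
      (hLm.pow 3).coeff_natDegree, mul_one]

/-- Every hyperelliptic curve of genus 2, `y² = f(x)` with `f` squarefree of degree 5
over `F_p`, has an affine `F_p`-rational point for every prime `p ≥ 17`. -/
theorem genus_two_has_point (p : ℕ) (hp : p.Prime) (hge : 17 ≤ p)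
    (f : Polynomial (ZMod p)) (hdeg : f.natDegree = 5) (hsf : Squarefree f) :
    ∃ x y : ZMod p, y ^ 2 = f.eval x := by
  open Polynomial in
  have : Fact p.Prime := ⟨hp⟩
  by_contra! hno
  have cast_ne (n : ℕ) (h0 : 0 < n) (hn : n < p) : (n : ZMod p) ≠ 0 := by
    rw [Ne, ZMod.natCast_eq_zero_iff]
    exact Nat.not_dvd_of_pos_of_lt h0 hn
  have hf0 (a : ZMod p) : f.eval a ≠ 0 := fun h => hno a 0 (by simp [h])
  have hfp (a : ZMod p) : f.eval a ^ (p / 2) = -1 := by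
    refine (ZMod.pow_div_two_eq_neg_one_or_one p (hf0 a)).resolve_left fun h => ?_
    obtain ⟨y, hy⟩ := (ZMod.euler_criterion p (hf0 a)).mpr h
    exact hno a y (by rw [hy, sq])
  have hodd : 2 * (p / 2) + 1 = p := Nat.two_mul_div_two_add_one_of_odd (hp.odd_of_ne_two (by omega))
  have hG : 2 * f * derivative (f ^ (p / 2)) = -derivative f * f ^ (p / 2) := by
    have hc : (2 * ((p / 2 : ℕ) : (ZMod p)[X]) + 1) = 0 := by
      have := congrArg (Nat.cast : ℕ → (ZMod p)[X]) hodd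
      rw [CharP.cast_eq_zero (ZMod p)[X] p] at this
      exact_mod_cast this
    obtain ⟨k, hk⟩ : ∃ k, p / 2 = k + 1 := ⟨p / 2 - 1, by omega⟩
    rw [hk] at hc ⊢
    rw [derivative_pow, Nat.add_sub_cancel, map_natCast]
    linear_combination f ^ (k + 1) * derivative f * hc
  have hL : derivative (X ^ p - X : (ZMod p)[X]) = -1 := by
    simp [derivative_X_pow]
  obtain ⟨hPd, hPc⟩ := taylorAux_natDegree_le_and_coeff (G := f ^ (p / 2)) hp.one_lt hdeg.le
    (by rw [natDegree_pow, hdeg]; omega)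
  have hP0 : taylorAux f (f ^ (p / 2)) (X ^ p - X) ≠ 0 := by
    intro h
    rw [h, coeff_zero] at hPc
    have hlc : f.coeff 5 ≠ 0 := by
      rw [← hdeg, coeff_natDegree, leadingCoeff_ne_zero]
      rintro rfl
      simp at hdeg
    exact mul_ne_zero (cast_ne 15 (by norm_num) (by omega)) (pow_ne_zero 3 hlc) hPc.symm
  have h2 : (2 : ZMod p) ≠ 0 := cast_ne 2 (by norm_num) (by omega)
  have hle := card_mul_le_natDegree (n := 4) hP0 fun a =>
    X_sub_C_pow_four_dvd h2 (cast_ne 3 (by norm_num) (by omega))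
      (by simp [taylorAux, hfp]) (by simp) (by simpa [h2] using hf0 a) (taylorAux_ode hG hL)
  rw [ZMod.card] at hle
  omega
end

section
/- Let p be a prime with p ≥ 37 and let f be a squarefree polynomial of degree 7 over F_p. Then there exists a point (x,y) ∈ F_p × F_p with y² = f(x); that is, every hyperelliptic curve of genus 3 over F_p has an affine F_p-rational point for all primes p ≥ 37. -/
open Polynomial

/-- Over a field, the numerators `Pₙ` of the Hasse derivatives of `y = √f`:
the `n`-th Hasse derivative of `y` is `Pₙ * y / f ^ n`. -/
noncomputable def sqrtHasseNum {F : Type*} [Field F] (f : F[X]) : ℕ → F[X]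
  | 0 => 1
  | n + 1 => C ((2 * (n + 1) : F)⁻¹) *
      (2 * f * derivative (sqrtHasseNum f n)
        - C (2 * n - 1 : F) * derivative f * sqrtHasseNum f n)

section sqrtHasseNum

variable {F : Type*} [Field F] (f : F[X])

theorem sqrtHasseNum_zero : sqrtHasseNum f 0 = 1 := by rw [sqrtHasseNum]

theorem sqrtHasseNum_succ (n : ℕ) : sqrtHasseNum f (n + 1) = C ((2 * (n + 1) : F)⁻¹) *
      (2 * f * derivative (sqrtHasseNum f n)
        - C (2 * n - 1 : F) * derivative f * sqrtHasseNum f n) := by rw [sqrtHasseNum]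

theorem sqrtHasseNum_recurrence (n : ℕ) (hn : (2 * (n + 1) : F) ≠ 0) :
    2 * f * derivative (sqrtHasseNum f n) =
      C (2 * (n + 1) : F) * sqrtHasseNum f (n + 1)
        + C (2 * n - 1 : F) * derivative f * sqrtHasseNum f n := by
  rw [sqrtHasseNum_succ, ← mul_assoc, ← C_mul, mul_inv_cancel₀ hn, C_1]
  ring

theorem natDegree_sqrtHasseNum_le {d : ℕ} (hf : f.natDegree ≤ d + 1) (n : ℕ) :
    (sqrtHasseNum f n).natDegree ≤ d * n := by
  induction n with
  | zero => simp [sqrtHasseNum_zero]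
  | succ n ih =>
    have hf' : (derivative f).natDegree ≤ d := (natDegree_derivative_le f).trans (by omega)
    have hP' : (2 * f * derivative (sqrtHasseNum f n)).natDegree ≤ d * (n + 1) := by
      rcases Nat.eq_zero_or_pos (sqrtHasseNum f n).natDegree with h0 | hpos
      · rw [derivative_of_natDegree_zero h0]; simp
      · have h2 : (2 * f : F[X]).natDegree ≤ d + 1 := by
          have := natDegree_C_mul_le (2 : F) f
          rw [map_ofNat] at this
          omega
        have h3 := natDegree_derivative_le (sqrtHasseNum f n)
        refine natDegree_mul_le.trans ?_
        rw [mul_add, mul_one]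
        omega
    rw [sqrtHasseNum_succ]
    refine (natDegree_C_mul_le _ _).trans ((natDegree_sub_le _ _).trans (max_le hP' ?_))
    rw [mul_assoc, mul_add, mul_one, add_comm]
    exact (natDegree_C_mul_le _ _).trans (natDegree_mul_le_of_le hf' ih)

theorem coeff_sqrtHasseNum_succ {d : ℕ} (hd : 0 < d) (hf : f.natDegree ≤ d + 1) (n : ℕ) :
    (sqrtHasseNum f (n + 1)).coeff (d * (n + 1)) =
      (2 * (n + 1) : F)⁻¹ * (d + 1 - 2 * n) * f.coeff (d + 1) *
        (sqrtHasseNum f n).coeff (d * n) := by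
  have hf' : (derivative f).natDegree ≤ d := (natDegree_derivative_le f).trans (by omega)
  have hP := natDegree_sqrtHasseNum_le f hf n
  have hB : (derivative f * sqrtHasseNum f n).coeff (d * (n + 1)) =
      f.coeff (d + 1) * (d + 1) * (sqrtHasseNum f n).coeff (d * n) := by
    rw [mul_add, mul_one, add_comm, coeff_mul_add_eq_of_natDegree_le hf' hP, coeff_derivative]
  have hA : (f * derivative (sqrtHasseNum f n)).coeff (d * (n + 1)) =
      f.coeff (d + 1) * (d * n) * (sqrtHasseNum f n).coeff (d * n) := by
    rcases n with _ | n
    · simp [sqrtHasseNum_zero]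
    · have hP' : (derivative (sqrtHasseNum f (n + 1))).natDegree ≤ d * (n + 1) - 1 :=
        (natDegree_derivative_le _).trans (by omega)
      have hpos : 0 < d * (n + 1) := by positivity
      have h1 : d * (n + 1 + 1) = (d + 1) + (d * (n + 1) - 1) := by
        rw [mul_add d (n + 1) 1]; omega
      rw [h1, coeff_mul_add_eq_of_natDegree_le hf hP', coeff_derivative, ← Nat.cast_add_one,
        Nat.sub_add_cancel hpos]
      push_cast
      ring
  rw [sqrtHasseNum_succ, coeff_C_mul, coeff_sub, mul_assoc 2, mul_assoc (C _), coeff_C_mul,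
    ← map_ofNat C 2, coeff_C_mul, hA, hB]
  ring

end sqrtHasseNum

theorem pow_succ_dvd_of_derivative_eq {F : Type*} [Field F] {t f E A B : F[X]} {n : ℕ}
    (ht : derivative t = -1) (ht0 : t ≠ 0) (hcop : IsCoprime t f)
    (hn : ∀ k : ℕ, 0 < k → k ≤ n → (2 * k : F) ≠ 0) (hE : t ∣ E)
    (hode : 2 * f * derivative E = A * E + t ^ n * B) : t ^ (n + 1) ∣ E := by
  suffices h : ∀ k ≤ n, t ^ (k + 1) ∣ E from h n le_rfl
  intro k
  induction k with
  | zero => intro _; simpa using hE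
  | succ k ih =>
    intro hk
    obtain ⟨M, rfl⟩ := ih (by omega)
    obtain ⟨r, rfl⟩ := Nat.exists_eq_add_of_le hk
    have hu := hn (k + 1) k.succ_pos hk
    have key : C (2 * (k + 1 : ℕ) : F) * (f * M) =
        t * (2 * f * derivative M - A * M - t ^ r * B) := by
      apply mul_left_cancel₀ (pow_ne_zero k ht0)
      simp only [derivative_mul, derivative_pow, ht, Nat.add_sub_cancel] at hode
      simp only [C_mul, map_natCast, map_ofNat] at hode ⊢
      linear_combination (-1 : F[X]) * hode
    have hdvd : t ∣ f * M :=
      (IsUnit.dvd_mul_left ((isUnit_iff_ne_zero.mpr hu).map C)).mp (Dvd.intro _ key.symm)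
    obtain ⟨N, rfl⟩ := hcop.dvd_of_dvd_mul_left hdvd
    exact ⟨N, by ring⟩

theorem X_pow_sub_X_dvd_of_eval_eq_zero {p : ℕ} [Fact p.Prime] {g : (ZMod p)[X]}
    (hg : ∀ a, g.eval a = 0) : (X ^ p - X : (ZMod p)[X]) ∣ g := by
  rcases eq_or_ne g 0 with rfl | hg0
  · exact dvd_zero _
  have hp1 := (Fact.out : p.Prime).one_lt
  have hroots : (X ^ p - X : (ZMod p)[X]).roots = Finset.univ.val := by
    simpa using FiniteField.roots_X_pow_card_sub_X (ZMod p)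
  have hmonic : (X ^ p - X : (ZMod p)[X]).Monic :=
    monic_X_pow_sub (by rw [degree_X]; exact_mod_cast hp1)
  have hprod := prod_multiset_X_sub_C_of_monic_of_roots_card_eq hmonic (by
    rw [hroots, FiniteField.X_pow_card_sub_X_natDegree_eq _ hp1]
    simp [ZMod.card])
  rw [← hprod, Multiset.prod_X_sub_C_dvd_iff_le_roots hg0, hroots]
  exact (Multiset.le_iff_subset Finset.univ.nodup).mpr fun a _ => by simpa [hg0] using hg a

/-- Every hyperelliptic curve of genus 3, `y² = f(x)` with `f` squarefree of degree 7
over `F_p`, has an affine `F_p`-rational point for every prime `p ≥ 37`. -/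
theorem genus_three_has_point (p : ℕ) (hp : p.Prime) (hge : 37 ≤ p)
    (f : Polynomial (ZMod p)) (hdeg : f.natDegree = 7) (hsf : Squarefree f) :
    ∃ x y : ZMod p, y ^ 2 = f.eval x := by
  by_contra! hno
  have : Fact p.Prime := ⟨hp⟩
  obtain ⟨m, hm⟩ : ∃ m, p = 2 * m + 1 := hp.odd_of_ne_two (by omega)
  have hcast : ∀ k : ℕ, 0 < k → k < 37 → (k : ZMod p) ≠ 0 := fun k h0 h1 h =>
    absurd (Nat.le_of_dvd h0 ((ZMod.natCast_eq_zero_iff k p).mp h)) (by omega)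
  have h2m : (2 * m + 1 : ZMod p) = 0 := by
    have : ((2 * m + 1 : ℕ) : ZMod p) = 0 := by rw [← hm]; exact ZMod.natCast_self p
    exact_mod_cast this
  have hf0 : f ≠ 0 := by rintro rfl; simp at hdeg
  set s : (ZMod p)[X] := -f ^ m with hs
  set t : (ZMod p)[X] := X ^ p - X with htdef
  have ht : derivative t = -1 := by simp [htdef, derivative_X_pow]
  have htdeg : t.natDegree = p := FiniteField.X_pow_card_sub_X_natDegree_eq _ hp.one_lt
  have ht0 : t ≠ 0 := FiniteField.X_pow_card_sub_X_ne_zero _ hp.one_lt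
  have hs' : 2 * f * derivative s = -derivative f * s := by
    have h2m' : (2 * (m : (ZMod p)[X]) + 1) = 0 := by
      have := congrArg C h2m
      simpa only [map_add, map_mul, map_ofNat, map_natCast, map_one, map_zero] using this
    have hm0 : m ≠ 0 := by omega
    have hpow : f * f ^ (m - 1) = f ^ m := mul_pow_sub_one hm0 f
    rw [hs, derivative_neg, derivative_pow, map_natCast]
    linear_combination (-2 * (m : (ZMod p)[X]) * derivative f) * hpow
      - derivative f * f ^ m * h2m'
  have hts : t ∣ s - 1 := X_pow_sub_X_dvd_of_eval_eq_zero fun a => by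
    have ha0 : f.eval a ≠ 0 := fun h => hno a 0 (by simp [h])
    have hm2 : p / 2 = m := by omega
    have hnsq : f.eval a ^ m ≠ 1 := fun h => by
      rw [← hm2] at h
      obtain ⟨y, hy⟩ := (ZMod.euler_criterion p ha0).mpr h
      exact hno a y (by rw [hy, sq])
    have := (ZMod.pow_div_two_eq_neg_one_or_one p ha0).resolve_left (by rwa [hm2])
    rw [hm2] at this
    simp [hs, this]
  have hcop : IsCoprime t f := by
    obtain ⟨q, hq⟩ := hts
    have hm0 : m ≠ 0 := by omega
    refine ⟨-q, -f ^ (m - 1), ?_⟩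
    have hpow : f ^ (m - 1) * f = f ^ m := pow_sub_one_mul hm0 f
    linear_combination hq - hpow
  set P := sqrtHasseNum f with hP
  have hP0 : P 0 = 1 := sqrtHasseNum_zero f
  have hrec : ∀ n : ℕ, n ≤ 5 → 2 * f * derivative (P n) =
      C (2 * (n + 1) : ZMod p) * P (n + 1) + C (2 * n - 1 : ZMod p) * derivative f * P n :=
    fun n hn => sqrtHasseNum_recurrence f n (by
      exact_mod_cast hcast (2 * (n + 1)) (by omega) (by omega))
  set E := s * f ^ 5 - (f ^ 5 + t * P 1 * f ^ 4 + t ^ 2 * P 2 * f ^ 3 + t ^ 3 * P 3 * f ^ 2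
    + t ^ 4 * P 4 * f + t ^ 5 * P 5) with hE
  have htE : t ∣ E := by
    obtain ⟨q, hq⟩ := hts
    refine ⟨q * f ^ 5 - (P 1 * f ^ 4 + t * P 2 * f ^ 3 + t ^ 2 * P 3 * f ^ 2
      + t ^ 3 * P 4 * f + t ^ 4 * P 5), ?_⟩
    linear_combination f ^ 5 * hq
  have hode : 2 * f * derivative E = 9 * derivative f * E + t ^ 5 * (-12 * P 6) := by
    have h0 := hrec 0 (by norm_num)
    have h1 := hrec 1 (by norm_num)
    have h2 := hrec 2 (by norm_num)
    have h3 := hrec 3 (by norm_num)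
    have h4 := hrec 4 (by norm_num)
    have h5 := hrec 5 (by norm_num)
    simp only [hP0, derivative_one] at h0
    simp only [map_add, map_sub, map_mul, map_ofNat, map_one, Nat.cast_ofNat,
      Nat.cast_one, Nat.cast_zero, map_zero] at h0 h1 h2 h3 h4 h5
    norm_num at h0 h1 h2 h3 h4 h5
    simp only [hE, derivative_add, derivative_sub, derivative_mul, derivative_pow, ht,
      map_natCast]
    push_cast
    norm_num
    linear_combination f ^ 5 * hs' - f ^ 5 * h0 - t * f ^ 4 * h1 - t ^ 2 * f ^ 3 * h2
      - t ^ 3 * f ^ 2 * h3 - t ^ 4 * f * h4 - t ^ 5 * h5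
  have hE6 : t ^ 6 ∣ E := pow_succ_dvd_of_derivative_eq ht ht0 hcop
    (fun k h0 h5 => by exact_mod_cast hcast (2 * k) (by omega) (by omega)) htE hode
  have hPdeg : ∀ n, (P n).natDegree ≤ 6 * n := natDegree_sqrtHasseNum_le f hdeg.le
  have hterm : ∀ i k a b c d n : ℕ, a + b = n → c + d = n →
      (t ^ i * (P a * P b - P c * P d) * f ^ k).natDegree ≤ p * i + 6 * n + 7 * k := by
    intro i k a b c d n hab hcd
    have h1 : (t ^ i).natDegree ≤ p * i := by rw [natDegree_pow, htdeg, mul_comm]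
    have h2 : (f ^ k).natDegree ≤ 7 * k := by rw [natDegree_pow, hdeg, mul_comm]
    have h3 : (P a * P b).natDegree ≤ 6 * n :=
      (natDegree_mul_le_of_le (hPdeg a) (hPdeg b)).trans (by omega)
    have h4 : (P c * P d).natDegree ≤ 6 * n :=
      (natDegree_mul_le_of_le (hPdeg c) (hPdeg d)).trans (by omega)
    exact natDegree_mul_le_of_le
      (natDegree_mul_le_of_le h1 ((natDegree_sub_le _ _).trans (max_le h3 h4))) h2
  have hsdeg : s.natDegree = 7 * m := by rw [hs, natDegree_neg, natDegree_pow, hdeg, mul_comm]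
  have hs0 : s ≠ 0 := neg_ne_zero.mpr (pow_ne_zero m hf0)
  have hc : f.coeff 7 ≠ 0 := by
    rw [← hdeg]
    exact leadingCoeff_ne_zero.mpr hf0
  have hP5c : (P 5).coeff 30 ≠ 0 := by
    have hstep : ∀ n : ℕ, n ≤ 4 → (P n).coeff (6 * n) ≠ 0 →
        (P (n + 1)).coeff (6 * (n + 1)) ≠ 0 := by
      intro n hn h
      rw [hP, coeff_sqrtHasseNum_succ f (by norm_num) hdeg.le n]
      refine mul_ne_zero (mul_ne_zero (mul_ne_zero (inv_ne_zero ?_) ?_) hc) h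
      · exact_mod_cast hcast (2 * (n + 1)) (by omega) (by omega)
      · have h1 := hcast 1 (by norm_num) (by norm_num)
        have h3 := hcast 3 (by norm_num) (by norm_num)
        have h5 := hcast 5 (by norm_num) (by norm_num)
        have h7 := hcast 7 (by norm_num) (by norm_num)
        interval_cases n <;> norm_num at h1 h3 h5 h7 ⊢ <;> assumption
    have h0 : (P 0).coeff (6 * 0) ≠ 0 := by simp [hP0]
    exact hstep 4 (by norm_num) <| hstep 3 (by norm_num) <| hstep 2 (by norm_num) <|
      hstep 1 (by norm_num) <| hstep 0 (by norm_num) h0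
  have hP5deg : (P 5).natDegree = 30 := natDegree_eq_of_le_of_coeff_ne_zero (hPdeg 5) hP5c
  have hP50 : P 5 ≠ 0 := by intro h; simp [h] at hP5c
  set L := s * f ^ 3 * t * P 5 with hL
  have hLdeg : L.natDegree = 9 * m + 52 := by
    rw [hL, natDegree_mul (mul_ne_zero (mul_ne_zero hs0 (pow_ne_zero 3 hf0)) ht0) hP50,
      natDegree_mul (mul_ne_zero hs0 (pow_ne_zero 3 hf0)) ht0,
      natDegree_mul hs0 (pow_ne_zero 3 hf0), natDegree_pow, hsdeg, hdeg, htdeg, hP5deg]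
    omega
  set R := s * f ^ 4 * P 4 - (t ^ 0 * (P 4 * P 0 - 0) * f ^ 4
    + t ^ 1 * (P 4 * P 1 - P 5 * P 0) * f ^ 3 + t ^ 2 * (P 4 * P 2 - P 5 * P 1) * f ^ 2
    + t ^ 3 * (P 4 * P 3 - P 5 * P 2) * f ^ 1 + t ^ 4 * (P 4 * P 4 - P 5 * P 3) * f ^ 0) with hR
  have hRdeg : R.natDegree ≤ 8 * m + 52 := by
    have hfirst : (s * f ^ 4 * P 4).natDegree ≤ 7 * m + 28 + 24 := by
      refine natDegree_mul_le_of_le (natDegree_mul_le_of_le hsdeg.le ?_) (hPdeg 4)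
      rw [natDegree_pow, hdeg]
    have h0 : (t ^ 0 * (P 4 * P 0 - 0) * f ^ 4).natDegree ≤ 8 * m + 52 := by
      rw [pow_zero, one_mul, sub_zero, hP0, mul_one]
      refine (natDegree_mul_le_of_le (hPdeg 4) (natDegree_pow f 4).le).trans ?_
      omega
    have h1 := hterm 1 3 4 1 5 0 5 rfl rfl
    have h2 := hterm 2 2 4 2 5 1 6 rfl rfl
    have h3 := hterm 3 1 4 3 5 2 7 rfl rfl
    have h4 := hterm 4 0 4 4 5 3 8 rfl rfl
    refine (natDegree_sub_le _ _).trans (max_le (hfirst.trans (by omega)) ?_)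
    refine natDegree_add_le_of_degree_le (natDegree_add_le_of_degree_le
      (natDegree_add_le_of_degree_le (natDegree_add_le_of_degree_le h0 ?_) ?_) ?_) ?_ <;> omega
  have hdvd : t ^ 6 ∣ R - L := by
    have hfQ : f ^ 2 * (R - L) = E * (P 4 * f - t * P 5) - t ^ 6 * P 5 ^ 2 := by
      rw [hR, hL, hE, hP0]
      ring
    refine (hcop.pow (m := 6) (n := 2)).dvd_of_dvd_mul_left ?_
    rw [hfQ]
    exact dvd_sub (hE6.mul_right _) (dvd_mul_right _ _)
  have hzero : R - L = 0 := by
    refine eq_zero_of_dvd_of_natDegree_lt hdvd ?_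
    refine ((natDegree_sub_le _ _).trans (max_le (hRdeg.trans (by omega)) hLdeg.le)).trans_lt ?_
    rw [natDegree_pow, htdeg]
    omega
  rw [sub_eq_zero.mp hzero, hLdeg] at hRdeg
  omega
end

section
/- (Conjecture.) For every squarefree monic polynomial f of degree 7 over F_29 there exists a point (x,y) ∈ F_29 × F_29 with y² = f(x); that is, every hyperelliptic curve of genus 3 over F_29 has an affine F_29-rational point. -/
/-- The bitwise union of the numbers `b t <<< (t * w)` over `t < n`. -/
def concatBlocks (w : ℕ) (b : ℕ → ℕ) : ℕ → ℕ
  | 0 => 0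
  | n + 1 => concatBlocks w b n ||| (b n <<< (n * w))

theorem testBit_concatBlocks {w : ℕ} {b : ℕ → ℕ} {n t i : ℕ} (ht : t < n)
    (h : (b t).testBit i = true) : (concatBlocks w b n).testBit (t * w + i) = true := by
  induction n with
  | zero => omega
  | succ n ih =>
    rw [concatBlocks, Nat.testBit_or, Bool.or_eq_true]
    rcases Nat.lt_succ_iff_lt_or_eq.mp ht with h' | rfl
    · exact Or.inl (ih h')
    · right
      simp [Nat.testBit_shiftLeft, h]

/-- A bit set indexed by `t * 29 ^ k + ∑ i < k, a i * 29 ^ i` with `t < 58` and digits `a i < 29`: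
it contains every index for which `t * x ^ k + ∑ i < k, a i * x ^ i` is not a square modulo 29.
The numeral lists the `t < 58` that are not squares modulo 29. -/
def nonsquareTable (x : ℕ) : ℕ → ℕ
  | 0 => 109735252828544268
  | k + 1 => concatBlocks (29 ^ (k + 1))
      (fun t => (nonsquareTable x k >>> ((t * x % 29) * 29 ^ k)) % 2 ^ 29 ^ (k + 1)) 58

theorem testBit_nonsquareTable_zero :
    ∀ t < 58, ¬ IsSquare ((t : ℕ) : ZMod 29) →
      Nat.testBit 109735252828544268 t = true := by
  decide +kernel

theorem sum_val_mul_pow_lt (a : ℕ → ZMod 29) (k : ℕ) :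
    ∑ i ∈ Finset.range k, (a i).val * 29 ^ i < 29 ^ k := by
  induction k with
  | zero => simp
  | succ k ih =>
    rw [Finset.sum_range_succ, pow_succ]
    have h : (a k).val ≤ 28 := Nat.lt_succ_iff.mp (ZMod.val_lt (a k))
    nlinarith [Nat.mul_le_mul_right (29 ^ k) h]

theorem testBit_nonsquareTable (x : ℕ) (a : ℕ → ZMod 29) (k : ℕ) {t : ℕ} (ht : t < 58)
    (h : ¬ IsSquare ((t : ZMod 29) * x ^ k + ∑ i ∈ Finset.range k, a i * (x : ZMod 29) ^ i)) :
    (nonsquareTable x k).testBit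
      (t * 29 ^ k + ∑ i ∈ Finset.range k, (a i).val * 29 ^ i) = true := by
  induction k generalizing t with
  | zero =>
    simpa [nonsquareTable] using testBit_nonsquareTable_zero t ht (by simpa using h)
  | succ k ih =>
    rw [nonsquareTable]
    apply testBit_concatBlocks ht
    rw [Nat.testBit_mod_two_pow, Bool.and_eq_true, decide_eq_true_iff, Nat.testBit_shiftRight]
    refine ⟨sum_val_mul_pow_lt a (k + 1), ?_⟩
    have hs : t * x % 29 + (a k).val < 58 := by
      have := ZMod.val_lt (a k)
      omega
    convert ih hs ?_ using 1
    · rw [Finset.sum_range_succ]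
      ring_nf
    · convert h using 2
      rw [Finset.sum_range_succ]
      push_cast [ZMod.natCast_mod, ZMod.natCast_zmod_val]
      ring

/-- A bit set containing the index `∑ i < 4, a i * 29 ^ i` of every digit sequence `a` for which
`x ^ 7 + c * x ^ 5 + d * x ^ 4 + ∑ i < 4, a i * x ^ i` is not a square modulo 29 for all `x < n`. -/
def nonsquareSeptics (c d : ℕ) : ℕ → ℕ
  | 0 => 2 ^ 29 ^ 4 - 1
  | n + 1 => nonsquareSeptics c d n &&&
      (nonsquareTable n 3 >>> ((n ^ 4 + c * n ^ 2 + d * n) % 29 * 29 ^ 3))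

theorem testBit_nonsquareSeptics (c d : ℕ) (a : ℕ → ZMod 29) (n : ℕ)
    (h : ∀ x : ZMod 29, ¬ IsSquare
      (x ^ 7 + c * x ^ 5 + d * x ^ 4 + ∑ i ∈ Finset.range 4, a i * x ^ i)) :
    (nonsquareSeptics c d n).testBit (∑ i ∈ Finset.range 4, (a i).val * 29 ^ i) = true := by
  induction n with
  | zero =>
    rw [nonsquareSeptics, Nat.testBit_two_pow_sub_one, decide_eq_true_iff]
    exact sum_val_mul_pow_lt a 4
  | succ n ih =>
    rw [nonsquareSeptics, Nat.testBit_and, ih, Bool.true_and, Nat.testBit_shiftRight]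
    have hs : (n ^ 4 + c * n ^ 2 + d * n) % 29 + (a 3).val < 58 := by
      have := ZMod.val_lt (a 3)
      omega
    convert testBit_nonsquareTable n a 3 hs ?_ using 1
    · rw [Finset.sum_range_succ _ 3]
      ring_nf
    · convert h n using 2
      rw [Finset.sum_range_succ _ 3]
      push_cast [ZMod.natCast_mod, ZMod.natCast_zmod_val]
      ring

theorem nonsquareSeptics_eq_zero :
    ∀ d < 3, ∀ c < 29, nonsquareSeptics c d 29 = 0 := by
  decide +kernel

theorem ZMod.exists_eq_mul_pow_six (d : ZMod 29) :
    ∃ w : ZMod 29, w ≠ 0 ∧ ∃ e < 3, d = (e : ℕ) * w ^ 6 := by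
  revert d
  decide +kernel

theorem exists_isSquare_depressed_septic (c d : ZMod 29) (a : ℕ → ZMod 29) :
    ∃ x : ZMod 29, IsSquare
      (x ^ 7 + c * x ^ 5 + d * x ^ 4 + ∑ i ∈ Finset.range 4, a i * x ^ i) := by
  have : Fact (Nat.Prime 29) := ⟨by norm_num⟩
  obtain ⟨w, hw, e, he, rfl⟩ := ZMod.exists_eq_mul_pow_six d
  by_contra! h
  have key := testBit_nonsquareSeptics (c / w ^ 4).val e (fun i => a i * w ^ (2 * i) / w ^ 14) 29 ?_
  · rw [nonsquareSeptics_eq_zero e he _ (ZMod.val_lt _)] at key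
    simp at key
  · rintro x ⟨y, hy⟩
    refine h (w ^ 2 * x) ⟨w ^ 7 * y, ?_⟩
    rw [mul_mul_mul_comm, ← hy]
    simp only [Finset.sum_range_succ, Finset.sum_range_zero, ZMod.natCast_zmod_val]
    field_simp
    ring

/-- (Conjecture.) Every hyperelliptic curve of genus 3 over `F_29`, `y² = f(x)` with
`f` squarefree monic of degree 7, has an affine `F_29`-rational point. -/
theorem genus_three_over_F29_has_point
    (f : Polynomial (ZMod 29)) (hmonic : f.Monic) (hdeg : f.natDegree = 7)
    (hsf : Squarefree f) :
    ∃ x y : ZMod 29, y ^ 2 = f.eval x := by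
  have : Fact (Nat.Prime 29) := ⟨by norm_num⟩
  set g := f.taylor (4 * f.coeff 6) with hg
  have hg7 : g.coeff 7 = 1 := by
    rw [hg, ← hdeg, Polynomial.coeff_taylor_natDegree, hmonic.leadingCoeff]
  have hg6 : g.coeff 6 = 0 := by
    have h7 : f.coeff 7 = 1 := by rw [← hdeg, hmonic.coeff_natDegree]
    have h1 : (Polynomial.hasseDeriv 6 f).natDegree < 2 := by
      have := Polynomial.natDegree_hasseDeriv_le f 6
      omega
    rw [hg, Polynomial.taylor_coeff, Polynomial.eval_eq_sum_range' h1]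
    simp only [Finset.sum_range_succ, Finset.sum_range_zero, Polynomial.hasseDeriv_coeff, h7]
    norm_num
    linear_combination f.coeff 6 * (CharP.ofNat_eq_zero (ZMod 29) 29)
  obtain ⟨x, y, hy⟩ := exists_isSquare_depressed_septic (g.coeff 5) (g.coeff 4) g.coeff
  refine ⟨x + 4 * f.coeff 6, y, ?_⟩
  rw [← Polynomial.taylor_eval, ← hg, Polynomial.eval_eq_sum_range, hg, Polynomial.natDegree_taylor,
    ← hg, hdeg, pow_two, ← hy]
  simp only [Finset.sum_range_succ, hg6, hg7]
  ring
end
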